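/- Let M be the local dyadic maximal operator with respect to an open set Ω ⊆ ℝ^d, let E ⊆ ℝ^d have locally finite perimeter, and λ ∈ (0,1). Then H^{d-1}(∂*{M1_E > λ} ∩ Ω) ≤ C_d · λ^{-(d-1)/d} · H^{d-1}(∂*E ∩ Ω). -/

import Mathlib

open MeasureTheory Metric Set Filter
open scoped ENNReal

noncomputable def mClos {d : ℕ} (E : Set (EuclideanSpace ℝ (Fin d))) :
    Set (EuclideanSpace ℝ (Fin d)) :=
  {x | 0 < Filter.limsup
      (fun r : ℝ => volume (Metric.ball x r ∩ E) / ENNReal.ofReal (r ^ d))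
      (nhdsWithin 0 (Set.Ioi 0))}

noncomputable def mBdry {d : ℕ} (E : Set (EuclideanSpace ℝ (Fin d))) :
    Set (EuclideanSpace ℝ (Fin d)) :=
  mClos E ∩ mClos Eᶜ

noncomputable def divg {d : ℕ} (φ : EuclideanSpace ℝ (Fin d) → EuclideanSpace ℝ (Fin d))
    (x : EuclideanSpace ℝ (Fin d)) : ℝ :=
  ∑ i, fderiv ℝ φ x (EuclideanSpace.single i 1) i

noncomputable def var {d : ℕ} (Ω : Set (EuclideanSpace ℝ (Fin d)))
    (f : EuclideanSpace ℝ (Fin d) → ℝ) : ℝ≥0∞ :=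
  ⨆ (φ : EuclideanSpace ℝ (Fin d) → EuclideanSpace ℝ (Fin d)) (_ : ContDiff ℝ 1 φ)
    (_ : HasCompactSupport φ) (_ : tsupport φ ⊆ Ω) (_ : ∀ x, ‖φ x‖ ≤ 1),
    ENNReal.ofReal (∫ x in Ω, f x * divg φ x)

def HasLocFinitePerimeter {d : ℕ} (E : Set (EuclideanSpace ℝ (Fin d))) : Prop :=
  ∀ U : Set (EuclideanSpace ℝ (Fin d)), IsOpen U → Bornology.IsBounded U →
    var U (E.indicator fun _ => (1 : ℝ)) < ⊤

/-- The half-open dyadic cube of generation `n` indexed by `k ∈ ℤ^d`. -/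
def dyadCube {d : ℕ} (n : ℤ) (k : Fin d → ℤ) : Set (EuclideanSpace ℝ (Fin d)) :=
  {x | ∀ i, (k i : ℝ) * 2 ^ n ≤ x i ∧ x i < ((k i : ℝ) + 1) * 2 ^ n}

/-- The local dyadic maximal function of `1_E` with respect to `Ω`. -/
noncomputable def dyadMax {d : ℕ} (Ω E : Set (EuclideanSpace ℝ (Fin d)))
    (x : EuclideanSpace ℝ (Fin d)) : ℝ≥0∞ :=
  ⨆ (n : ℤ) (k : Fin d → ℤ) (_ : x ∈ dyadCube n k) (_ : dyadCube n k ⊆ Ω),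
    volume (E ∩ dyadCube n k) / volume (dyadCube n k)

section basics
variable {d : ℕ}

lemma nm_mClos {E : Set (EuclideanSpace ℝ (Fin d))} {x : EuclideanSpace ℝ (Fin d)} :
    x ∉ mClos E ↔ ∀ ε : ℝ, 0 < ε → ∃ δ > 0, ∀ r, 0 < r → r < δ →
      volume (ball x r ∩ E) ≤ ENNReal.ofReal (ε * r ^ d) := by
  have h1 : x ∉ mClos E ↔ Tendsto (fun r : ℝ => volume (ball x r ∩ E) / ENNReal.ofReal (r ^ d))
      (nhdsWithin 0 (Set.Ioi 0)) (nhds 0) := by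
    simp only [mClos, mem_setOf_eq, not_lt, nonpos_iff_eq_zero]
    constructor
    · intro h
      exact tendsto_of_le_liminf_of_limsup_le (zero_le) (le_of_eq h)
    · intro h
      exact h.limsup_eq
  rw [h1, ENNReal.tendsto_nhds_zero]
  constructor
  · intro h ε hε
    have := h (ENNReal.ofReal ε) (by simpa using hε)
    rw [eventually_nhdsWithin_iff, Metric.eventually_nhds_iff] at this
    obtain ⟨δ, hδ, H⟩ := this
    refine ⟨δ, hδ, fun r hr hrδ => ?_⟩
    have h2 := H (y := r) (by simpa [abs_of_pos hr] using hrδ) hr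
    have h3 : (0:ℝ) < r ^ d := by positivity
    rw [ENNReal.div_le_iff (by simpa using h3) (by simp)] at h2
    rwa [ENNReal.ofReal_mul hε.le]
  · intro h ε hε
    by_cases hT : ε = ⊤
    · simp [hT]
    obtain ⟨δ, hδ, H⟩ := h ε.toReal (ENNReal.toReal_pos hε.ne' hT)
    rw [eventually_nhdsWithin_iff, Metric.eventually_nhds_iff]
    refine ⟨δ, hδ, fun r hr hr0 => ?_⟩
    have hr0 : 0 < r := hr0
    have h2 := H r hr0 (by simpa [abs_of_pos hr0] using hr)
    have h3 : (0:ℝ) < r ^ d := by positivity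
    rw [ENNReal.div_le_iff (by simpa using h3) (by simp)]
    rwa [ENNReal.ofReal_mul ENNReal.toReal_nonneg, ENNReal.ofReal_toReal hT] at h2

/-- density one points -/
lemma ae_mClos {E : Set (EuclideanSpace ℝ (Fin d))} (hE : MeasurableSet E) :
    volume (Eᶜ ∩ mClos E) = 0 := by
  have h := Besicovitch.ae_tendsto_measure_inter_div_of_measurableSet
    (volume : Measure (EuclideanSpace ℝ (Fin d))) hE
  rw [ae_iff] at h
  refine measure_mono_null ?_ h
  rintro x ⟨hx, hxE⟩
  simp only [mem_setOf_eq]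
  intro ht
  refine absurd hxE ?_
  rw [nm_mClos]
  rw [indicator_of_notMem hx, ENNReal.tendsto_nhds_zero] at ht
  intro ε hε
  set v := volume (closedBall (0 : EuclideanSpace ℝ (Fin d)) 1) with hv
  have hv0 : v ≠ ⊤ := measure_closedBall_lt_top.ne
  have hv1 : 0 < v := measure_closedBall_pos _ _ one_pos
  have := ht (ENNReal.ofReal ε / v) (ENNReal.div_pos (by simpa using hε) hv0)
  rw [eventually_nhdsWithin_iff, Metric.eventually_nhds_iff] at this
  obtain ⟨δ, hδ, H⟩ := this
  refine ⟨δ, hδ, fun r hr hrδ => ?_⟩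
  have h2 := H (y := r) (by simpa [abs_of_pos hr] using hrδ) hr
  have h4 : volume (closedBall x r) = ENNReal.ofReal (r ^ d) * v := by
    rw [Measure.addHaar_closedBall' _ _ hr.le]; simp [hv]
  have h3 : (0:ℝ) < r ^ d := by positivity
  rw [h4, ENNReal.div_le_iff (by
    simp only [ne_eq, mul_eq_zero, not_or]; exact ⟨by simpa using h3, hv1.ne'⟩)
    (ENNReal.mul_ne_top (by simp) hv0)] at h2
  calc volume (ball x r ∩ E) ≤ volume (E ∩ closedBall x r) := by
        apply measure_mono; rintro y ⟨h, h'⟩; exact ⟨h', ball_subset_closedBall h⟩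
    _ ≤ _ := h2
    _ = ENNReal.ofReal ε * ENNReal.ofReal (r ^ d) * (v / v) := by
        simp only [div_eq_mul_inv]; ring
    _ = _ := by rw [ENNReal.div_self hv1.ne' hv0, mul_one, ENNReal.ofReal_mul hε.le]

/-- uniform thin set -/
def thin (c : ℝ) (E : Set (EuclideanSpace ℝ (Fin d))) (k : ℕ) : Set (EuclideanSpace ℝ (Fin d)) :=
  {x | ∀ r : ℝ, 0 < r → r < 1 / ((k : ℝ) + 1) →
    volume (ball x r ∩ E) ≤ ENNReal.ofReal (c * r ^ d)}

lemma thin_closed (c : ℝ) (E : Set (EuclideanSpace ℝ (Fin d))) (k : ℕ) :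
    IsClosed (thin c E k) := by
  rw [← isOpen_compl_iff, Metric.isOpen_iff]
  intro x hx
  simp only [thin, mem_compl_iff, mem_setOf_eq, not_forall, not_le] at hx
  obtain ⟨r, hr, hrk, hlt⟩ := hx
  have h1 : ball x r ∩ E = ⋃ n : ℕ, (ball x (r - 1 / ((n:ℝ) + 1)) ∩ E) := by
    rw [← iUnion_inter]
    congr 1
    ext y
    simp only [mem_ball, mem_iUnion]
    constructor
    · intro h
      obtain ⟨n, hn⟩ := exists_nat_one_div_lt (sub_pos.2 h)
      exact ⟨n, by linarith⟩
    · rintro ⟨n, hn⟩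
      have : (0:ℝ) < 1 / ((n:ℝ) + 1) := by positivity
      linarith
  have h2 : Monotone fun n : ℕ => (ball x (r - 1 / ((n:ℝ) + 1)) ∩ E) := by
    intro a b hab
    apply inter_subset_inter_left
    apply ball_subset_ball
    have : 1 / ((b:ℝ) + 1) ≤ 1 / ((a:ℝ) + 1) := by
      apply one_div_le_one_div_of_le (by positivity)
      have : (a:ℝ) ≤ b := by exact_mod_cast hab
      linarith
    linarith
  rw [h1, h2.measure_iUnion, lt_iSup_iff] at hlt
  obtain ⟨n, hn⟩ := hlt
  refine ⟨1 / ((n:ℝ) + 1), by positivity, fun y hy => ?_⟩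
  simp only [thin, mem_compl_iff, mem_setOf_eq, not_forall, not_le]
  refine ⟨r, hr, hrk, hn.trans_le ?_⟩
  apply measure_mono
  apply inter_subset_inter_left
  apply ball_subset_ball'
  rw [mem_ball, dist_comm] at hy
  linarith

lemma exists_thin {c : ℝ} (hc : 0 < c) {E : Set (EuclideanSpace ℝ (Fin d))}
    {x : EuclideanSpace ℝ (Fin d)} (hx : x ∉ mClos E) : ∃ k, x ∈ thin c E k := by
  obtain ⟨δ, hδ, H⟩ := nm_mClos.1 hx c hc
  obtain ⟨k, hk⟩ := exists_nat_one_div_lt hδ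
  exact ⟨k, fun r hr hrk => H r hr (hrk.trans hk)⟩

lemma vol_ball (x : EuclideanSpace ℝ (Fin d)) {r : ℝ} (hr : 0 < r) :
    volume (ball x r) = ENNReal.ofReal (r ^ d) * volume (ball (0 : EuclideanSpace ℝ (Fin d)) 1) := by
  rw [Measure.addHaar_ball_of_pos _ _ hr]; simp

lemma thin_not {c : ℝ} (hc : 0 < c)
    (hc1 : ENNReal.ofReal (2 * c) < volume (ball (0 : EuclideanSpace ℝ (Fin d)) 1))
    {E : Set (EuclideanSpace ℝ (Fin d))}
    {x : EuclideanSpace ℝ (Fin d)} {k : ℕ} (hx : x ∈ thin c E k) : x ∈ mClos Eᶜ := by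
  by_contra h
  obtain ⟨δ, hδ, H⟩ := nm_mClos.1 h c hc
  obtain ⟨r, hr, hr2⟩ := exists_between (lt_min hδ (show (0:ℝ) < 1 / ((k : ℝ) + 1) by positivity))
  have h1 := H r hr (hr2.trans_le (min_le_left _ _))
  have h2 := hx r hr (hr2.trans_le (min_le_right _ _))
  have h3 : volume (ball x r) ≤ ENNReal.ofReal (r ^ d) * ENNReal.ofReal (2 * c) := by
    calc volume (ball x r) ≤ volume (ball x r ∩ E) + volume (ball x r ∩ Eᶜ) := by
          refine le_trans (measure_mono ?_) (measure_union_le _ _)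
          rw [← inter_union_distrib_left, union_compl_self, inter_univ]
      _ ≤ _ := add_le_add h2 h1
      _ = _ := by
        rw [← ENNReal.ofReal_add (by positivity) (by positivity),
          ← ENNReal.ofReal_mul (by positivity)]
        congr 1; ring
  rw [vol_ball x hr] at h3
  have h4 : (0:ℝ) < r ^ d := by positivity
  rw [ENNReal.mul_le_mul_iff_right (by simpa using h4) (by simp)] at h3
  exact absurd hc1 (not_lt.2 h3)

lemma mClos_interior {U : Set (EuclideanSpace ℝ (Fin d))} {x : EuclideanSpace ℝ (Fin d)}
    (h : U ∈ nhds x) : x ∉ mClos Uᶜ := by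
  rw [nm_mClos]
  obtain ⟨δ, hδ, H⟩ := Metric.mem_nhds_iff.1 h
  intro ε hε
  refine ⟨δ, hδ, fun r hr hrd => ?_⟩
  have : ball x r ∩ Uᶜ = ∅ := by
    ext y; simp only [mem_inter_iff, mem_compl_iff, mem_empty_iff_false, iff_false, not_and, not_not]
    exact fun hy => H (ball_subset_ball hrd.le hy)
  simp [this]
end basics

lemma baire_line {a b : ℝ} (hab : a ≤ b) (f : ℝ → Bool) (A : ℕ → Bool → Set ℝ)
    (hcl : ∀ k s, IsClosed (A k s))
    (hA : ∀ k s t, t ∈ Icc a b → t ∈ A k s → f t = s)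
    (hcov : ∀ t ∈ Icc a b, ∃ k, t ∈ A k (f t))
    (hR : ∀ k s t v, a ≤ t → t < v → v ≤ b → t ∈ A k s → ¬ ∀ u, t < u → u < v → f u = !s)
    (hL : ∀ k s t v, t ≤ b → v < t → a ≤ v → t ∈ A k s → ¬ ∀ u, v < u → u < t → f u = !s) :
    f a = f b := by
  let loc : ℝ → Prop := fun t => ∃ ε > 0, ∀ s ∈ Icc a b, |s - t| < ε → f s = f t
  have h0 : ∀ S : Set ℝ, IsPreconnected S → S ⊆ Icc a b → (∀ t ∈ S, loc t) →
      ∀ x ∈ S, ∀ y ∈ S, f x = f y := by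
    intro S hS hSab hl x hx y hy
    refine hS.constant (f := f) ?_ hx hy
    intro t ht
    obtain ⟨ε, hε, H⟩ := hl t ht
    have : ∀ᶠ s in nhdsWithin t S, f s = f t := by
      rw [eventually_nhdsWithin_iff, Metric.eventually_nhds_iff]
      exact ⟨ε, hε, fun s hs hsS => H s (hSab hsS) hs⟩
    exact (tendsto_congr' this).2 tendsto_const_nhds
  by_cases hall : ∀ t ∈ Icc a b, loc t
  · exact h0 _ isPreconnected_Icc subset_rfl hall a ⟨le_rfl, hab⟩ b ⟨hab, le_rfl⟩
  exfalso
  push Not at hall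
  let C : Set ℝ := {t | t ∈ Icc a b ∧ ¬ loc t}
  have hCcl : IsClosed C := by
    rw [← isOpen_compl_iff, Metric.isOpen_iff]
    intro t ht
    by_cases hti : t ∈ Icc a b
    · have hl : loc t := by
        by_contra h; exact ht ⟨hti, h⟩
      obtain ⟨ε, hε, H⟩ := hl
      refine ⟨ε, hε, fun t' ht' => ?_⟩
      rintro ⟨h1, h2⟩
      apply h2
      rw [mem_ball, Real.dist_eq] at ht'
      refine ⟨ε - |t' - t|, by linarith, fun s hs hst => ?_⟩
      rw [H t' h1 ht', H s hs]
      have := abs_sub_le s t' t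
      linarith
    · obtain ⟨ε, hε, H⟩ := Metric.isOpen_iff.1 (isClosed_Icc (a := a) (b := b)).isOpen_compl t hti
      exact ⟨ε, hε, fun t' ht' h => H ht' h.1⟩
  obtain ⟨t1, ht1, ht1'⟩ := hall
  haveI : Nonempty C := ⟨⟨t1, ht1, ht1'⟩⟩
  haveI : CompleteSpace C := hCcl.completeSpace_coe
  obtain ⟨⟨k, s⟩, ⟨⟨t0, ht0⟩, hint⟩⟩ := nonempty_interior_of_iUnion_of_closed
    (f := fun p : ℕ × Bool => {c : C | c.1 ∈ A p.1 p.2})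
    (fun p => (hcl p.1 p.2).preimage continuous_subtype_val) (by
      ext ⟨c, hc⟩
      simp only [mem_iUnion, mem_univ, iff_true]
      obtain ⟨k, hk⟩ := hcov c hc.1
      exact ⟨⟨k, f c⟩, hk⟩)
  rw [mem_interior_iff_mem_nhds, Metric.mem_nhds_iff] at hint
  obtain ⟨ε, hε, H⟩ := hint
  have HC : ∀ t ∈ C, |t - t0| < ε → t ∈ A k s := fun t ht htt =>
    H (show (⟨t, ht⟩ : C) ∈ ball (⟨t0, ht0⟩ : C) ε from htt)
  have hCt0 : t0 ∈ A k s := HC t0 ht0 (by simpa using hε)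
  have hft0 : f t0 = s := hA k s t0 ht0.1 hCt0
  apply ht0.2
  refine ⟨ε, hε, fun q hq hqt => ?_⟩
  by_contra hne
  rw [hft0] at hne
  have hfq : f q = !s := by
    revert hne; cases f q <;> cases s <;> simp
  have hnotC : ∀ t, f t = !s → |t - t0| < ε → t ∉ C := by
    intro t ht htt htC
    have := hA k s t htC.1 (HC t htC htt)
    rw [this] at ht; cases s <;> simp at ht
  have hqt0 : q ≠ t0 := by rintro rfl; exact hnotC q hfq hqt ht0
  rcases lt_or_gt_of_ne hqt0 with hlt | hlt
  · -- q < t0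
    have hcp : IsCompact (C ∩ Icc q t0) := isCompact_Icc.inter_left hCcl
    obtain ⟨p, ⟨hpC, hpI⟩, hpm⟩ := hcp.exists_isLeast ⟨t0, ht0, hlt.le, le_rfl⟩
    have hpt : |p - t0| < ε := by
      rw [abs_lt] at hqt ⊢; constructor <;> linarith [hpI.1, hpI.2]
    have hqp : q < p := lt_of_le_of_ne hpI.1 (by
      rintro rfl; exact hnotC _ hfq hqt hpC)
    refine hL k s p q hpC.1.2 hqp hq.1 (HC p hpC hpt) ?_
    intro u hu1 hu2
    rw [← hfq]
    refine h0 (Ico q p) isPreconnected_Ico ?_ ?_ u ⟨hu1.le, hu2⟩ q ⟨le_rfl, hqp⟩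
    · rintro v ⟨hv1, hv2⟩; exact ⟨hq.1.trans hv1, hv2.le.trans hpC.1.2⟩
    · rintro v ⟨hv1, hv2⟩
      by_contra hl
      exact absurd (hpm ⟨⟨⟨hq.1.trans hv1, hv2.le.trans hpC.1.2⟩, hl⟩, hv1, hv2.le.trans hpI.2⟩)
        (not_le.2 hv2)
  · have hcp : IsCompact (C ∩ Icc t0 q) := isCompact_Icc.inter_left hCcl
    obtain ⟨p, ⟨hpC, hpI⟩, hpm⟩ := hcp.exists_isGreatest ⟨t0, ht0, le_rfl, hlt.le⟩
    have hpt : |p - t0| < ε := by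
      rw [abs_lt] at hqt ⊢; constructor <;> linarith [hpI.1, hpI.2]
    have hqp : p < q := lt_of_le_of_ne hpI.2 (by
      rintro rfl; exact hnotC _ hfq hqt hpC)
    refine hR k s p q hpC.1.1 hqp hq.2 (HC p hpC hpt) ?_
    intro u hu1 hu2
    rw [← hfq]
    refine h0 (Ioc p q) isPreconnected_Ioc ?_ ?_ u ⟨hu1, hu2.le⟩ q ⟨hqp, le_rfl⟩
    · rintro v ⟨hv1, hv2⟩; exact ⟨hpC.1.1.trans hv1.le, hv2.trans hq.2⟩
    · rintro v ⟨hv1, hv2⟩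
      by_contra hl
      exact absurd (hpm ⟨⟨⟨hpC.1.1.trans hv1.le, hv2.trans hq.2⟩, hl⟩, hpI.1.trans hv1.le, hv2⟩)
        (not_le.2 hv1)

lemma vb_pos (d : ℕ) : ∃ c : ℝ, 0 < c ∧
    ENNReal.ofReal (2 * c) < volume (ball (0 : EuclideanSpace ℝ (Fin d)) 1) := by
  have h1 : 0 < volume (ball (0 : EuclideanSpace ℝ (Fin d)) 1) := measure_ball_pos _ _ one_pos
  obtain ⟨q, hq, hq2⟩ := ENNReal.lt_iff_exists_nnreal_btwn.1 h1
  refine ⟨q / 2, by have := ENNReal.coe_pos.1 hq; positivity, ?_⟩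
  rw [mul_div_cancel₀ _ (two_ne_zero), ENNReal.ofReal_coe_nnreal]; exact hq2

lemma compl_mClos_sub {d : ℕ} (E : Set (EuclideanSpace ℝ (Fin d))) {x} (hx : x ∉ mClos E) :
    x ∈ mClos Eᶜ := by
  obtain ⟨c, hc, h⟩ := vb_pos d
  obtain ⟨k, hk⟩ := exists_thin hc hx
  exact thin_not hc h hk

lemma null_aux {m : ℕ} (Φ : (Fin m → ℝ) × ℝ → EuclideanSpace ℝ (Fin (m + 1)))
    (hΦ : MeasurePreserving Φ volume volume)
    (hL : ∀ p q, dist (Φ p) (Φ q) ≤ ((m : ℝ) + 1) * dist p q)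
    {E : Set (EuclideanSpace ℝ (Fin (m + 1)))} (hE : MeasurableSet E) {c : ℝ} (hc : 0 < c)
    (hc1 : c * (3 * ((m : ℝ) + 1)) ^ (m + 1) ≤ 1 / 4) (k : ℕ) (t0 η : ℝ) (hη : 0 < η) :
    volume {y | ∃ t ∈ Ico t0 (t0 + η), Φ (y, t) ∈ thin c E k ∧
      ∀ u, t < u → u < t + 3 * η → Φ (y, u) ∉ mClos Eᶜ} = 0 := by
  set A := {y | ∃ t ∈ Ico t0 (t0 + η), Φ (y, t) ∈ thin c E k ∧
      ∀ u, t < u → u < t + 3 * η → Φ (y, u) ∉ mClos Eᶜ} with hAdef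
  have key : ∀ z : Fin m → ℝ, ∀ r, 0 < r → r < η → 3 * ((m : ℝ) + 1) * r < 1 / ((k : ℝ) + 1) →
      volume (A ∩ closedBall z r) / volume (closedBall z r) ≤ 1 / 2 := by
    intro z r hr hrη hrk
    have hvb : volume (closedBall z r) = ENNReal.ofReal ((2 * r) ^ m) := by
      rw [Real.volume_pi_closedBall z hr.le]; simp
    have hpow : r ^ m ≤ (2 * r) ^ m := by gcongr; linarith
    have hrm : 0 < r ^ m := by positivity
    suffices h : volume (A ∩ closedBall z r) ≤ ENNReal.ofReal (r ^ m / 2) by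
      rw [hvb, ENNReal.div_le_iff (by simp; positivity) (by simp)]
      refine h.trans ?_
      rw [show (1 / 2 : ℝ≥0∞) = ENNReal.ofReal (1 / 2) by
        rw [ENNReal.ofReal_div_of_pos two_pos]; simp]
      rw [← ENNReal.ofReal_mul (by norm_num)]
      apply ENNReal.ofReal_le_ofReal
      linarith
    rcases (A ∩ closedBall z r).eq_empty_or_nonempty with h | ⟨y0, hy0A, hy0B⟩
    · rw [h]; simp
    set T := {t | t ∈ Ico t0 (t0 + η) ∧ ∃ y ∈ closedBall z r, Φ (y, t) ∈ thin c E k ∧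
      ∀ u, t < u → u < t + 3 * η → Φ (y, u) ∉ mClos Eᶜ} with hT
    have hTn : T.Nonempty := by
      obtain ⟨t, ht, h1, h2⟩ := hy0A
      exact ⟨t, ht, y0, hy0B, h1, h2⟩
    have hTb : BddAbove T := ⟨t0 + η, fun t ht => ht.1.2.le⟩
    obtain ⟨b, hbT, hb⟩ := exists_lt_of_lt_csSup hTn (show sSup T - r / 2 < sSup T by linarith)
    obtain ⟨hbI, yb, hyb, hbthin, -⟩ := hbT
    have hsub : (A ∩ closedBall z r) ×ˢ Ioo (b + r / 2) (b + r) ⊆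
        Φ ⁻¹' (ball (Φ (yb, b)) (3 * ((m : ℝ) + 1) * r) ∩ E) ∪ Φ ⁻¹' (Eᶜ ∩ mClos E) := by
      rintro ⟨y, u⟩ ⟨⟨⟨t, ht, hth, htI⟩, hyB⟩, hu⟩
      have htT : t ∈ T := ⟨ht, y, hyB, hth, htI⟩
      have htb : t ≤ sSup T := le_csSup hTb htT
      simp only at hu hyB
      have h1 : Φ (y, u) ∉ mClos Eᶜ :=
        htI u (by linarith [hu.1]) (by linarith [hu.2, hbI.2, ht.1])
      have h2 : Φ (y, u) ∈ ball (Φ (yb, b)) (3 * ((m : ℝ) + 1) * r) := by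
        rw [mem_ball]
        refine (hL _ _).trans_lt ?_
        have : dist (y, u) (yb, b) ≤ 2 * r := by
          rw [Prod.dist_eq, max_le_iff]
          constructor
          · have := dist_triangle_right y yb z
            rw [mem_closedBall] at hyB hyb
            simp only
            linarith
          · simp only [Real.dist_eq]
            rw [abs_le]; constructor <;> linarith [hu.1, hu.2]
        have hm : (0:ℝ) < (m:ℝ) + 1 := by positivity
        calc ((m:ℝ) + 1) * dist (y, u) (yb, b) ≤ ((m:ℝ) + 1) * (2 * r) := by gcongr
          _ < _ := by nlinarith [mul_pos hm hr]
      by_cases hEm : Φ (y, u) ∈ E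
      · exact Or.inl ⟨h2, hEm⟩
      · refine Or.inr ⟨hEm, ?_⟩
        have := compl_mClos_sub Eᶜ h1
        rwa [compl_compl] at this
    have h3 : volume (A ∩ closedBall z r) * ENNReal.ofReal (r / 2) ≤
        ENNReal.ofReal (c * (3 * ((m : ℝ) + 1) * r) ^ (m + 1)) := by
      calc volume (A ∩ closedBall z r) * ENNReal.ofReal (r / 2)
          = volume ((A ∩ closedBall z r) ×ˢ Ioo (b + r / 2) (b + r)) := by
            rw [Measure.volume_eq_prod, Measure.prod_prod, Real.volume_Ioo]
            congr 2; ring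
        _ ≤ _ := measure_mono hsub
        _ ≤ _ := measure_union_le _ _
        _ = volume (ball (Φ (yb, b)) (3 * ((m : ℝ) + 1) * r) ∩ E) := by
            rw [hΦ.measure_preimage (measurableSet_ball.inter hE).nullMeasurableSet,
              hΦ.measure_preimage (NullMeasurableSet.of_null (ae_mClos hE)), ae_mClos hE, add_zero]
        _ ≤ _ := hbthin _ (by positivity) hrk
    have h4 : volume (A ∩ closedBall z r) * ENNReal.ofReal (r / 2) ≤
        ENNReal.ofReal (r ^ m / 2) * ENNReal.ofReal (r / 2) := by
      refine h3.trans ?_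
      rw [← ENNReal.ofReal_mul (by positivity)]
      apply ENNReal.ofReal_le_ofReal
      rw [mul_pow]
      have : c * ((3 * ((m:ℝ) + 1)) ^ (m + 1) * r ^ (m + 1)) =
        (c * (3 * ((m:ℝ) + 1)) ^ (m + 1)) * (r ^ m * r) := by ring
      rw [this]
      have : (0:ℝ) ≤ r ^ m * r := by positivity
      nlinarith
    rwa [ENNReal.mul_le_mul_iff_left (by simp; positivity) (by simp)] at h4
  have hd := Besicovitch.ae_tendsto_measure_inter_div (volume : Measure (Fin m → ℝ)) A
  have hF : ∀ᵐ x ∂(volume.restrict A : Measure (Fin m → ℝ)), False := by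
    filter_upwards [hd] with z hz
    have hev : ∀ᶠ r in nhdsWithin (0:ℝ) (Ioi 0),
        volume (A ∩ closedBall z r) / volume (closedBall z r) ≤ 1 / 2 := by
      rw [eventually_nhdsWithin_iff, Metric.eventually_nhds_iff]
      refine ⟨min η (1 / ((k : ℝ) + 1) / (3 * ((m : ℝ) + 1))), by positivity, fun r hr hr0 => ?_⟩
      have hr0 : 0 < r := hr0
      rw [Real.dist_eq, sub_zero, abs_of_pos hr0, lt_min_iff, lt_div_iff₀ (by positivity)] at hr
      exact key z r hr0 hr.1 (by linarith [hr.2])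
    have := le_of_tendsto hz hev
    norm_num at this
  have : volume.restrict A (univ : Set (Fin m → ℝ)) = 0 := by
    rw [ae_iff] at hF; simpa using hF
  simpa using this

/-- transitions -/
lemma null_trans {m : ℕ} (Φ : (Fin m → ℝ) × ℝ → EuclideanSpace ℝ (Fin (m + 1)))
    (hΦ : MeasurePreserving Φ volume volume)
    (hL : ∀ p q, dist (Φ p) (Φ q) ≤ ((m : ℝ) + 1) * dist p q)
    {E : Set (EuclideanSpace ℝ (Fin (m + 1)))} (hE : MeasurableSet E) {c : ℝ} (hc : 0 < c)
    (hc1 : c * (3 * ((m : ℝ) + 1)) ^ (m + 1) ≤ 1 / 4) :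
    ∀ᵐ y : Fin m → ℝ, ∀ (k : ℕ) (t v : ℝ), t < v → Φ (y, t) ∈ thin c E k →
      ¬ ∀ u, t < u → u < v → Φ (y, u) ∉ mClos Eᶜ := by
  have h : ∀ (k j : ℕ) (q : ℤ), ∀ᵐ y : Fin m → ℝ,
      ¬ ∃ t ∈ Ico (q * (1 / ((j:ℝ) + 1))) (q * (1 / ((j:ℝ) + 1)) + (1 / ((j:ℝ) + 1))),
      Φ (y, t) ∈ thin c E k ∧
      ∀ u, t < u → u < t + 3 * (1 / ((j:ℝ) + 1)) → Φ (y, u) ∉ mClos Eᶜ := by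
    intro k j q
    have := null_aux Φ hΦ hL hE hc hc1 k (q * (1 / ((j:ℝ) + 1))) (1 / ((j:ℝ) + 1)) (by positivity)
    rw [ae_iff]; simpa only [not_not] using this
  simp only [← ae_all_iff] at h
  filter_upwards [h] with y hy k t v htv hth hu
  obtain ⟨j, hj⟩ := exists_nat_one_div_lt (show 0 < (v - t) / 3 by linarith)
  have hj0 : (0:ℝ) < 1 / ((j:ℝ) + 1) := by positivity
  set η := 1 / ((j:ℝ) + 1)
  refine hy k j ⌊t / η⌋ ⟨t, ⟨?_, ?_⟩, hth, fun u h1 h2 => hu u h1 (by linarith)⟩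
  · have := Int.floor_le (t / η)
    rwa [le_div_iff₀ hj0] at this
  · have := Int.lt_floor_add_one (t / η)
    rw [div_lt_iff₀ hj0] at this
    linarith

lemma distE_le {d : ℕ} (x y : EuclideanSpace ℝ (Fin d)) {D : ℝ} (hD : 0 ≤ D)
    (h : ∀ i, |x i - y i| ≤ D) : dist x y ≤ d * D := by
  rw [EuclideanSpace.dist_eq, Real.sqrt_le_iff]
  refine ⟨by positivity, ?_⟩
  calc ∑ i, dist (x i) (y i) ^ 2 ≤ ∑ i : Fin d, D ^ 2 := by
        apply Finset.sum_le_sum; intro i _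
        rw [Real.dist_eq]; gcongr; exact h i
    _ = d * D ^ 2 := by simp
    _ ≤ _ := by
      rw [mul_pow]
      gcongr
      rcases Nat.eq_zero_or_pos d with rfl | hd
      · simp
      · have : (1:ℝ) ≤ d := by exact_mod_cast hd
        nlinarith

noncomputable def lin {m : ℕ} (i : Fin (m + 1)) (y : Fin m → ℝ) (t : ℝ) :
    EuclideanSpace ℝ (Fin (m + 1)) := WithLp.toLp 2 (i.insertNth (α := fun _ => ℝ) t y)

@[simp] lemma lin_same {m : ℕ} (i : Fin (m + 1)) (y : Fin m → ℝ) (t : ℝ) : lin i y t i = t := by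
  simp [lin]
@[simp] lemma lin_succ {m : ℕ} (i : Fin (m + 1)) (y : Fin m → ℝ) (t : ℝ) (j : Fin m) :
    lin i y t (i.succAbove j) = y j := by
  simp [lin]

lemma lin_ext {m : ℕ} (i : Fin (m + 1)) (x : EuclideanSpace ℝ (Fin (m + 1))) :
    lin i (fun j => x (i.succAbove j)) (x i) = x := by
  ext j
  rcases Fin.eq_self_or_eq_succAbove i j with rfl | ⟨j, rfl⟩ <;> simp

lemma lin_mp {m : ℕ} (i : Fin (m + 1)) :
    MeasurePreserving (fun p : (Fin m → ℝ) × ℝ => lin i p.1 p.2) volume volume := by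
  have h1 := (volume_preserving_piFinSuccAbove (fun _ : Fin (m + 1) => ℝ) i).symm
  have h2 := (PiLp.volume_preserving_toLp (Fin (m + 1))).comp h1
  have h3 : MeasurePreserving (Prod.swap : (Fin m → ℝ) × ℝ → ℝ × (Fin m → ℝ)) volume volume :=
    Measure.measurePreserving_swap
  exact h2.comp h3

lemma lin_mp' {m : ℕ} (i : Fin (m + 1)) :
    MeasurePreserving (fun p : (Fin m → ℝ) × ℝ => lin i p.1 (-p.2)) volume volume := by
  have h3 : MeasurePreserving (Prod.map id (fun t : ℝ => -t) :
      (Fin m → ℝ) × ℝ → (Fin m → ℝ) × ℝ) volume volume :=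
    (MeasurePreserving.id _).prod (Measure.measurePreserving_neg volume)
  exact (lin_mp i).comp h3

lemma lin_dist {m : ℕ} (i : Fin (m + 1)) (y y' : Fin m → ℝ) (t t' : ℝ) :
    dist (lin i y t) (lin i y' t') ≤ ((m : ℝ) + 1) * max (dist y y') (dist t t') := by
  have := distE_le (lin i y t) (lin i y' t') (D := max (dist y y') (dist t t'))
    (le_max_of_le_left dist_nonneg) (by
      intro j
      rcases Fin.eq_self_or_eq_succAbove i j with rfl | ⟨j, rfl⟩
      · simp only [lin_same]; exact le_max_right _ _
      · simp only [lin_succ]; exact (dist_le_pi_dist y y' j).trans (le_max_left _ _))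
  simpa using this

lemma lin_cont {m : ℕ} (i : Fin (m + 1)) (y : Fin m → ℝ) : Continuous (lin i y) := by
  have : LipschitzWith (m + 1) (lin i y) := LipschitzWith.of_dist_le_mul fun t t' => by
    have := lin_dist i y y t t'
    simpa using this
  exact this.continuous

lemma key_line {m : ℕ} (i : Fin (m + 1)) {E : Set (EuclideanSpace ℝ (Fin (m + 1)))}
    (hE : MeasurableSet E) :
    ∀ᵐ y : Fin m → ℝ, ∀ a b : ℝ, a ≤ b → (∀ t ∈ Icc a b, lin i y t ∉ mBdry E) →
      (lin i y a ∈ mClos E ↔ lin i y b ∈ mClos E) := by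
  obtain ⟨c0, hc0, hc0'⟩ := vb_pos (m + 1)
  set K : ℝ := (3 * ((m : ℝ) + 1)) ^ (m + 1) with hK
  have hKp : 0 < K := by positivity
  set c := min c0 (1 / 4 / K) with hcdef
  have hc : 0 < c := lt_min hc0 (by positivity)
  have hc1 : c * K ≤ 1 / 4 := by
    rw [← le_div_iff₀ hKp]; exact min_le_right _ _
  have hc2 : ENNReal.ofReal (2 * c) < volume (ball (0 : EuclideanSpace ℝ (Fin (m + 1))) 1) := by
    refine lt_of_le_of_lt (ENNReal.ofReal_le_ofReal ?_) hc0'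
    have := min_le_left c0 (1 / 4 / K)
    linarith
  have hd1 : ∀ p q : (Fin m → ℝ) × ℝ, dist (lin i p.1 p.2) (lin i q.1 q.2) ≤
    ((m : ℝ) + 1) * dist p q := fun p q => lin_dist i _ _ _ _
  have hd2 : ∀ p q : (Fin m → ℝ) × ℝ, dist (lin i p.1 (-p.2)) (lin i q.1 (-q.2)) ≤
    ((m : ℝ) + 1) * dist p q := fun p q => by
      have := lin_dist i p.1 q.1 (-p.2) (-q.2)
      rwa [dist_neg_neg] at this
  filter_upwards [null_trans _ (lin_mp i) hd1 hE hc hc1, null_trans _ (lin_mp i) hd1 hE.compl hc hc1,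
    null_trans _ (lin_mp' i) hd2 hE hc hc1, null_trans _ (lin_mp' i) hd2 hE.compl hc hc1]
    with y h1 h2 h3 h4 a b hab hB
  classical
  have hB1 : ∀ t ∈ Icc a b, lin i y t ∈ mClos E → lin i y t ∉ mClos Eᶜ :=
    fun t ht h h' => hB t ht ⟨h, h'⟩
  have hB2 : ∀ t ∈ Icc a b, lin i y t ∈ mClos Eᶜ → lin i y t ∉ mClos E :=
    fun t ht h h' => hB t ht ⟨h', h⟩
  have := baire_line hab (fun t => decide (lin i y t ∈ mClos E))
    (fun k s => if s then {t | lin i y t ∈ thin c Eᶜ k} else {t | lin i y t ∈ thin c E k})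
    (by
      intro k s
      cases s
      · exact (thin_closed c E k).preimage (lin_cont i y)
      · exact (thin_closed c Eᶜ k).preimage (lin_cont i y))
    (by
      intro k s t ht hA
      cases s
      · simpa using hB2 t ht (thin_not hc hc2 (by simpa using hA))
      · have := thin_not hc hc2 (E := Eᶜ) (by simpa using hA)
        simpa using this)
    (by
      intro t ht
      by_cases h : lin i y t ∈ mClos E
      · obtain ⟨k, hk⟩ := exists_thin hc (hB1 t ht h)
        exact ⟨k, by simpa [h] using hk⟩
      · obtain ⟨k, hk⟩ := exists_thin hc h
        exact ⟨k, by simpa [h] using hk⟩)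
    (by
      intro k s t v hat htv hvb hA hu
      cases s
      · refine h1 k t v htv (by simpa using hA) fun u hu1 hu2 => ?_
        have := hu u hu1 hu2
        exact hB1 u ⟨by linarith, by linarith⟩ (by simpa using this)
      · refine h2 k t v htv (by simpa using hA) fun u hu1 hu2 => ?_
        have := hu u hu1 hu2
        rw [compl_compl]
        simpa using this)
    (by
      intro k s t v htb hvt hav hA hu
      cases s
      · refine h3 k (-t) (-v) (by linarith) (by simpa using hA) fun u hu1 hu2 => ?_
        have := hu (-u) (by linarith) (by linarith)
        exact hB1 (-u) ⟨by linarith, by linarith⟩ (by simpa using this)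
      · refine h4 k (-t) (-v) (by linarith) (by simpa using hA) fun u hu1 hu2 => ?_
        have := hu (-u) (by linarith) (by linarith)
        rw [compl_compl]
        simpa using this)
  simpa using this

/-- open cube -/
def oc {d : ℕ} (a : Fin d → ℝ) (l : ℝ) : Set (EuclideanSpace ℝ (Fin d)) :=
  {x | ∀ i, a i < x i ∧ x i < a i + l}

lemma oc_open {d : ℕ} (a : Fin d → ℝ) (l : ℝ) : IsOpen (oc a l) := by
  have : oc a l = ⋂ i, ({x | a i < x i} ∩ {x | x i < a i + l}) := by
    ext x; simp [oc]
  rw [this]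
  refine isOpen_iInter_of_finite fun i => ?_
  exact (isOpen_lt (by fun_prop) (by fun_prop)).inter (isOpen_lt (by fun_prop) (by fun_prop))

lemma proj_haus {m : ℕ} (i : Fin (m + 1)) (S : Set (EuclideanSpace ℝ (Fin (m + 1)))) :
    volume ((fun x : EuclideanSpace ℝ (Fin (m + 1)) => fun j => x (i.succAbove j)) '' S) ≤
      μH[(m : ℝ)] S := by
  have hlip : LipschitzWith 1
      (fun x : EuclideanSpace ℝ (Fin (m + 1)) => fun j => x (i.succAbove j)) :=
    LipschitzWith.of_dist_le_mul fun x y => by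
      simp only [NNReal.coe_one, one_mul]
      rw [dist_pi_le_iff dist_nonneg]
      intro j
      exact PiLp.dist_apply_le x y _
  have := hlip.hausdorffMeasure_image_le (d := (m:ℝ)) (by positivity) S
  have h2 : (μH[(m:ℝ)] : Measure (Fin m → ℝ)) = volume := by
    have := hausdorffMeasure_pi_real (ι := Fin m)
    simpa using this
  rw [h2] at this
  simpa using this

lemma exists_T {m : ℕ} (i : Fin (m + 1)) {E : Set (EuclideanSpace ℝ (Fin (m + 1)))}
    (hE : MeasurableSet E) (a : Fin (m + 1) → ℝ) (l : ℝ) :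
    ∃ T : Set (Fin m → ℝ), MeasurableSet T ∧ volume T ≤ μH[(m : ℝ)] (mBdry E ∩ oc a l) ∧
      ∀ y ∉ T, (∀ j, a (i.succAbove j) < y j ∧ y j < a (i.succAbove j) + l) →
        ∀ s t, s ≤ t → (∀ u ∈ Icc s t, (a i < u ∧ u < a i + l) ∨ lin i y u ∉ mBdry E) →
        (lin i y s ∈ mClos E ↔ lin i y t ∈ mClos E) := by
  have hk := key_line i hE
  rw [ae_iff] at hk
  set N := {y | ¬ ∀ a b : ℝ, a ≤ b → (∀ t ∈ Icc a b, lin i y t ∉ mBdry E) →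
      (lin i y a ∈ mClos E ↔ lin i y b ∈ mClos E)} with hN
  set P := (fun x : EuclideanSpace ℝ (Fin (m + 1)) => fun j => x (i.succAbove j)) ''
    (mBdry E ∩ oc a l) with hP
  refine ⟨toMeasurable volume (N ∪ P), measurableSet_toMeasurable _ _, ?_, ?_⟩
  · rw [measure_toMeasurable]
    refine (measure_union_le _ _).trans ?_
    rw [hk, zero_add]
    exact proj_haus i _
  · intro y hy hya s t hst hu
    have hy' : y ∉ N ∪ P := fun h => hy (subset_toMeasurable _ _ h)
    have hyN : y ∉ N := fun h => hy' (Or.inl h)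
    have hyP : y ∉ P := fun h => hy' (Or.inr h)
    simp only [hN, mem_ofPred_eq, not_not] at hyN
    refine hyN s t hst fun u hui => ?_
    rcases hu u hui with h | h
    · intro hb
      apply hyP
      refine ⟨lin i y u, ⟨hb, ?_⟩, by ext j; simp⟩
      intro j
      rcases Fin.eq_self_or_eq_succAbove i j with rfl | ⟨j, rfl⟩
      · simpa using h
      · simpa using hya j
    · exact h

/-- box in pi-space -/
def bx {d : ℕ} (a : Fin d → ℝ) (l : ℝ) : Set (Fin d → ℝ) :=
  univ.pi fun i => Ioo (a i) (a i + l)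

noncomputable def nu {d : ℕ} (a : Fin d → ℝ) (l : ℝ) : Measure (Fin d → ℝ) :=
  Measure.pi fun i => volume.restrict (Ioo (a i) (a i + l))

lemma nu_eq {d : ℕ} (a : Fin d → ℝ) (l : ℝ) : nu a l = volume.restrict (bx a l) := by
  rw [nu, bx, volume_pi, Measure.restrict_pi_pi]

instance {d : ℕ} (a : Fin d → ℝ) (l : ℝ) : SigmaFinite (nu a l) := by
  rw [nu_eq]; infer_instance

def mix {d : ℕ} (j : ℕ) (p : (Fin d → ℝ) × (Fin d → ℝ)) : Fin d → ℝ :=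
  fun i => if i.val < j then p.2 i else p.1 i

lemma mix_meas {d : ℕ} (j : ℕ) : Measurable (mix (d := d) j) := by
  refine measurable_pi_lambda _ fun i => ?_
  unfold mix
  split_ifs <;> fun_prop

lemma mix_map {d : ℕ} (a : Fin d → ℝ) {l : ℝ} (hl : 0 < l) (j : ℕ) :
    ((nu a l).prod (nu a l)).map (mix j) = (ENNReal.ofReal l) ^ d • nu a l := by
  set L := (ENNReal.ofReal l) ^ d with hL
  have hL0 : L ≠ 0 := pow_ne_zero _ (by simpa using hl)
  have hLT : L ≠ ⊤ := ENNReal.pow_ne_top (by simp)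
  have h1 : nu a l = L⁻¹ • ((nu a l).prod (nu a l)).map (mix j) := by
    conv_lhs => rw [nu]
    refine Measure.pi_eq fun s hs => ?_
    rw [Measure.smul_apply, Measure.map_apply (mix_meas j) (MeasurableSet.univ_pi hs)]
    have hpre : mix j ⁻¹' (univ.pi s) = (univ.pi fun i => if i.val < j then univ else s i) ×ˢ
        (univ.pi fun i : Fin d => if i.val < j then s i else univ) := by
      ext ⟨x, y⟩
      simp only [mem_preimage, Set.mem_pi, mem_univ, true_imp_iff, mix, mem_prod]
      rw [← forall_and]
      refine forall_congr' fun i => ?_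
      split_ifs <;> simp
    rw [hpre, Measure.prod_prod]
    conv_lhs => rw [nu, Measure.pi_pi, Measure.pi_pi, ← Finset.prod_mul_distrib]
    have : ∀ i : Fin d, (volume.restrict (Ioo (a i) (a i + l))) (if i.val < j then univ else s i) *
        (volume.restrict (Ioo (a i) (a i + l))) (if i.val < j then s i else univ) =
        ENNReal.ofReal l * (volume.restrict (Ioo (a i) (a i + l))) (s i) := by
      intro i
      split_ifs
      · simp
      · rw [mul_comm]; simp
    rw [Finset.prod_congr rfl fun i _ => this i, Finset.prod_mul_distrib]
    simp only [Finset.prod_const, Finset.card_univ, Fintype.card_fin, smul_eq_mul]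
    rw [← hL, ← mul_assoc, ENNReal.inv_mul_cancel hL0 hLT, one_mul]
  conv_rhs => rw [h1]
  rw [smul_smul, ENNReal.mul_inv_cancel hL0 hLT, one_smul]

lemma vol_toLp {d : ℕ} (S : Set (EuclideanSpace ℝ (Fin d))) :
    volume {x : Fin d → ℝ | WithLp.toLp 2 x ∈ S} = volume S := by
  have h : MeasurePreserving (MeasurableEquiv.toLp 2 (Fin d → ℝ)) volume volume :=
    PiLp.volume_preserving_toLp (Fin d)
  exact h.measure_preimage_equiv S

lemma vol_slab {m : ℕ} (i : Fin (m + 1)) {T : Set (Fin m → ℝ)} (hT : MeasurableSet T)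
    (a l : ℝ) :
    volume {x : EuclideanSpace ℝ (Fin (m + 1)) | (fun j => x (i.succAbove j)) ∈ T ∧
      x i ∈ Ioo a (a + l)} = volume T * ENNReal.ofReal l := by
  have hm : MeasurableSet {x : EuclideanSpace ℝ (Fin (m + 1)) | (fun j => x (i.succAbove j)) ∈ T ∧
      x i ∈ Ioo a (a + l)} := by
    apply MeasurableSet.inter
    · exact measurableSet_preimage (f := fun x : EuclideanSpace ℝ (Fin (m + 1)) =>
        fun j => x (i.succAbove j)) (by fun_prop) hT
    · exact measurableSet_preimage (f := fun x : EuclideanSpace ℝ (Fin (m + 1)) => x i)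
        (by fun_prop) measurableSet_Ioo
  rw [← (lin_mp i).measure_preimage hm.nullMeasurableSet]
  have : (fun p : (Fin m → ℝ) × ℝ => lin i p.1 p.2) ⁻¹'
      {x : EuclideanSpace ℝ (Fin (m + 1)) | (fun j => x (i.succAbove j)) ∈ T ∧
      x i ∈ Ioo a (a + l)} = T ×ˢ Ioo a (a + l) := by
    ext ⟨y, t⟩; simp
  rw [this, Measure.volume_eq_prod, Measure.prod_prod, Real.volume_Ioo]
  congr 2; ring

lemma mix_lin {m : ℕ} (x y : Fin (m + 1) → ℝ) (j : Fin (m + 1)) :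
    WithLp.toLp 2 (mix j.val (x, y)) = lin j (fun q => mix j.val (x, y) (j.succAbove q)) (x j) ∧
    WithLp.toLp 2 (mix (j.val + 1) (x, y)) =
      lin j (fun q => mix j.val (x, y) (j.succAbove q)) (y j) := by
  constructor
  · ext q
    rcases Fin.eq_self_or_eq_succAbove j q with rfl | ⟨q, rfl⟩
    · simp [mix]
    · simp
  · ext q
    rcases Fin.eq_self_or_eq_succAbove j q with rfl | ⟨q, rfl⟩
    · simp [mix]
    · have : (j.succAbove q).val < j.val + 1 ↔ (j.succAbove q).val < j.val := by
        have : (j.succAbove q).val ≠ j.val := fun h => Fin.succAbove_ne j q (Fin.ext h)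
        omega
      simp [mix, this]

lemma poincare {m : ℕ} {E : Set (EuclideanSpace ℝ (Fin (m + 1)))}
    (hE : MeasurableSet E) (a : Fin (m + 1) → ℝ) {l : ℝ} (hl : 0 < l) :
    volume (mClos E ∩ oc a l) * volume (oc a l \ mClos E) ≤
      ((m : ℝ≥0∞) + 1) * (ENNReal.ofReal l ^ (m + 1) *
        (ENNReal.ofReal l * μH[(m : ℝ)] (mBdry E ∩ oc a l))) := by
  choose T hTm hTv hT using fun i => exists_T i hE a l
  set h := μH[(m : ℝ)] (mBdry E ∩ oc a l)
  have hbx : ∀ x : Fin (m + 1) → ℝ, x ∈ bx a l ↔ WithLp.toLp 2 x ∈ oc a l := by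
    intro x; simp [bx, oc, Set.mem_pi]
  have hbxm : MeasurableSet (bx a l) := MeasurableSet.univ_pi fun i => measurableSet_Ioo
  have hI : ∀ S : Set (EuclideanSpace ℝ (Fin (m + 1))), S ⊆ oc a l →
      nu a l {x | WithLp.toLp 2 x ∈ S} = volume S := by
    intro S hS
    rw [nu_eq, Measure.restrict_apply' hbxm, inter_eq_self_of_subset_left, vol_toLp]
    intro x hx
    exact (hbx x).2 (hS hx)
  rw [← hI _ inter_subset_right, ← hI _ sdiff_subset, ← Measure.prod_prod]
  set B : Fin (m + 1) → Set (Fin (m + 1) → ℝ) := fun i => {z | (fun j => z (i.succAbove j)) ∈ T i}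
    with hB
  have hBm : ∀ i, MeasurableSet (B i) := fun i =>
    measurableSet_preimage (f := fun z : Fin (m + 1) → ℝ => fun j => z (i.succAbove j))
      (by fun_prop) (hTm i)
  have hBv : ∀ i, nu a l (B i) ≤ ENNReal.ofReal l * h := by
    intro i
    rw [nu_eq, Measure.restrict_apply' hbxm]
    calc volume (B i ∩ bx a l) ≤ volume {x : Fin (m + 1) → ℝ | WithLp.toLp 2 x ∈
          {x : EuclideanSpace ℝ (Fin (m + 1)) | (fun j => x (i.succAbove j)) ∈ T i ∧
            x i ∈ Ioo (a i) (a i + l)}} := by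
          apply measure_mono
          rintro x ⟨h1, h2⟩
          exact ⟨h1, h2 i (mem_univ _)⟩
      _ = volume (T i) * ENNReal.ofReal l := by rw [vol_toLp, vol_slab i (hTm i)]
      _ ≤ _ := by rw [mul_comm]; gcongr; exact hTv i
  have hsub : {x : Fin (m + 1) → ℝ | WithLp.toLp 2 x ∈ mClos E ∩ oc a l} ×ˢ
      {x : Fin (m + 1) → ℝ | WithLp.toLp 2 x ∈ oc a l \ mClos E} ⊆
      ⋃ i : Fin (m + 1), mix i.val ⁻¹' (B i) := by
    rintro ⟨x, y⟩ ⟨⟨hxE, hxo⟩, ⟨hyo, hyE⟩⟩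
    by_contra hcon
    simp only [mem_iUnion, not_exists] at hcon
    have hstep : ∀ j : ℕ, j ≤ m + 1 → WithLp.toLp 2 (mix j (x, y)) ∈ mClos E := by
      intro j
      induction j with
      | zero =>
        intro _
        have e : mix 0 (x, y) = x := by ext i; simp [mix]
        rw [e]; exact hxE
      | succ j ih =>
        intro hj
        have ih := ih (by omega)
        obtain ⟨e1, e2⟩ := mix_lin x y ⟨j, by omega⟩
        set jj : Fin (m + 1) := ⟨j, by omega⟩ with hjj
        change WithLp.toLp 2 (mix j (x, y)) = _ at e1
        change WithLp.toLp 2 (mix (j + 1) (x, y)) = _ at e2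
        rw [e1] at ih
        rw [e2]
        have hmem : ∀ q, a (jj.succAbove q) < mix j (x, y) (jj.succAbove q) ∧
            mix j (x, y) (jj.succAbove q) < a (jj.succAbove q) + l := by
          intro q
          unfold mix
          split_ifs
          · exact hyo _
          · exact hxo _
        have hx := hxo jj
        have hy := hyo jj
        simp only at hx hy
        have hnT := hcon jj
        rcases le_total (x jj) (y jj) with hle | hle
        · refine (hT jj _ hnT hmem (x jj) (y jj) hle fun u hu => Or.inl ?_).1 ih
          exact ⟨hx.1.trans_le hu.1, hu.2.trans_lt hy.2⟩
        · refine (hT jj _ hnT hmem (y jj) (x jj) hle fun u hu => Or.inl ?_).2 ih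
          exact ⟨hy.1.trans_le hu.1, hu.2.trans_lt hx.2⟩
    have := hstep (m + 1) le_rfl
    apply hyE
    have e : mix (m + 1) (x, y) = y := by
      ext i; simp only [mix, i.isLt, if_true]
    rwa [e] at this
  calc _ ≤ _ := measure_mono hsub
    _ ≤ ∑ i : Fin (m + 1), ((nu a l).prod (nu a l)) (mix i.val ⁻¹' (B i)) :=
        measure_iUnion_fintype_le _ _
    _ ≤ ∑ i : Fin (m + 1), ENNReal.ofReal l ^ (m + 1) * (ENNReal.ofReal l * h) := by
        apply Finset.sum_le_sum
        intro i _
        rw [← Measure.map_apply (mix_meas _) (hBm i), mix_map a hl, Measure.smul_apply, smul_eq_mul]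
        gcongr
        exact hBv i
    _ = _ := by simp

/-- closed cube -/
def cc {d : ℕ} (a : Fin d → ℝ) (l : ℝ) : Set (EuclideanSpace ℝ (Fin d)) :=
  {x | ∀ i, a i ≤ x i ∧ x i ≤ a i + l}

lemma vol_E_le {d : ℕ} {E : Set (EuclideanSpace ℝ (Fin d))} (hE : MeasurableSet E)
    (S : Set (EuclideanSpace ℝ (Fin d))) : volume (E ∩ S) ≤ volume (mClos E ∩ S) := by
  have h := ae_mClos hE.compl
  rw [compl_compl] at h
  calc volume (E ∩ S) ≤ volume ((mClos E ∩ S) ∪ (E ∩ mClos Eᶜ)) := by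
        apply measure_mono
        rintro x ⟨hx, hxS⟩
        by_cases hc : x ∈ mClos E
        · exact Or.inl ⟨hc, hxS⟩
        · exact Or.inr ⟨hx, compl_mClos_sub E hc⟩
    _ ≤ _ := measure_union_le _ _
    _ = _ := by rw [h, add_zero]

lemma vol_diff_le {d : ℕ} {E : Set (EuclideanSpace ℝ (Fin d))} (hE : MeasurableSet E)
    (S : Set (EuclideanSpace ℝ (Fin d))) : volume (S \ E) ≤ volume (S \ mClos E) := by
  have h := ae_mClos hE
  calc volume (S \ E) ≤ volume ((S \ mClos E) ∪ (Eᶜ ∩ mClos E)) := by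
        apply measure_mono
        rintro x ⟨hx, hxS⟩
        by_cases hc : x ∈ mClos E
        · exact Or.inr ⟨hxS, hc⟩
        · exact Or.inl ⟨hx, hc⟩
    _ ≤ _ := measure_union_le _ _
    _ = _ := by rw [h, add_zero]

lemma poin2 {m : ℕ} {E : Set (EuclideanSpace ℝ (Fin (m + 1)))}
    (hE : MeasurableSet E) (a : Fin (m + 1) → ℝ) {l : ℝ} (hl : 0 < l)
    (hd : ENNReal.ofReal l ^ (m + 1) ≤ 2 ^ (m + 2) * volume (E ∩ oc a l)) :
    volume (oc a l \ mClos E) ≤ ENNReal.ofReal l *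
      (2 ^ (m + 2) * ((m : ℝ≥0∞) + 1) * μH[(m : ℝ)] (mBdry E ∩ oc a l)) := by
  set L := ENNReal.ofReal l with hL
  have hL0 : L ^ (m + 1) ≠ 0 := pow_ne_zero _ (by simpa [hL] using hl)
  have hLT : L ^ (m + 1) ≠ ⊤ := ENNReal.pow_ne_top (by simp [hL])
  have h1 := poincare hE a hl
  set h := μH[(m : ℝ)] (mBdry E ∩ oc a l)
  rw [← ENNReal.mul_le_mul_iff_right hL0 hLT]
  calc L ^ (m + 1) * volume (oc a l \ mClos E)
      ≤ 2 ^ (m + 2) * volume (E ∩ oc a l) * volume (oc a l \ mClos E) := by gcongr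
    _ ≤ 2 ^ (m + 2) * volume (mClos E ∩ oc a l) * volume (oc a l \ mClos E) := by
        gcongr 2 ^ (m + 2) * ?_ * _
        exact vol_E_le hE _
    _ ≤ 2 ^ (m + 2) * (((m : ℝ≥0∞) + 1) * (L ^ (m + 1) * (L * h))) := by
        rw [mul_assoc]; gcongr
    _ = _ := by ring

lemma iso_mid {m : ℕ} {E : Set (EuclideanSpace ℝ (Fin (m + 1)))}
    (hE : MeasurableSet E) (a : Fin (m + 1) → ℝ) {l : ℝ} (hl : 0 < l)
    (hd : ENNReal.ofReal l ^ (m + 1) ≤ 2 ^ (m + 2) * volume (E ∩ oc a l))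
    (hd2 : ENNReal.ofReal l ^ (m + 1) ≤ 2 * volume (oc a l \ E)) :
    ENNReal.ofReal l ^ m ≤
      2 * (2 ^ (m + 2) * ((m : ℝ≥0∞) + 1)) * μH[(m : ℝ)] (mBdry E ∩ oc a l) := by
  have h1 := poin2 hE a hl hd
  set L := ENNReal.ofReal l with hL
  have hL0 : L ≠ 0 := by simpa [hL] using hl
  have hLT : L ≠ ⊤ := by simp [hL]
  set h := μH[(m : ℝ)] (mBdry E ∩ oc a l)
  rw [← ENNReal.mul_le_mul_iff_right hL0 hLT]
  calc L * L ^ m = L ^ (m + 1) := by ring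
    _ ≤ 2 * volume (oc a l \ E) := hd2
    _ ≤ 2 * volume (oc a l \ mClos E) := by gcongr 2 * ?_; exact vol_diff_le hE _
    _ ≤ 2 * _ := by gcongr 2 * ?_
    _ = _ := by ring

/-- closed box -/
def cb {m : ℕ} (i : Fin (m + 1)) (a : Fin (m + 1) → ℝ) (l : ℝ) : Set (Fin m → ℝ) :=
  Icc (fun j => a (i.succAbove j)) (fun j => a (i.succAbove j) + l)

lemma vol_cb {m : ℕ} (i : Fin (m + 1)) (a : Fin (m + 1) → ℝ) {l : ℝ} :
    volume (cb i a l) = ENNReal.ofReal l ^ m := by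
  rw [cb, Real.volume_Icc_pi]; simp

lemma face_haus {m : ℕ} (i : Fin (m + 1)) (b : ℝ) (Y : Set (Fin m → ℝ)) :
    μH[(m : ℝ)] ((fun y => lin i y b) '' Y) ≤ ((m : ℝ≥0∞) + 1) ^ m * volume Y := by
  have hlip : LipschitzWith (m + 1) (fun y => lin i y b) :=
    LipschitzWith.of_dist_le_mul fun x y => by
      have := lin_dist i x y b b
      simpa using this
  have := hlip.hausdorffMeasure_image_le (d := (m:ℝ)) (by positivity) Y
  have h2 : (μH[(m:ℝ)] : Measure (Fin m → ℝ)) = volume := by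
    have := hausdorffMeasure_pi_real (ι := Fin m)
    simpa using this
  rw [h2] at this
  simpa using this

lemma bd_haus {m : ℕ} (a : Fin (m + 1) → ℝ) {l : ℝ} (W : Set (EuclideanSpace ℝ (Fin (m + 1))))
    (V : ℝ≥0∞)
    (hV : ∀ i, ∀ b, (b = a i ∨ b = a i + l) → volume {y ∈ cb i a l | lin i y b ∉ W} ≤ V) :
    μH[(m : ℝ)] ((cc a l \ oc a l) \ W) ≤ 2 * ((m : ℝ≥0∞) + 1) * (((m : ℝ≥0∞) + 1) ^ m * V) := by
  have hsub : (cc a l \ oc a l) \ W ⊆ ⋃ i : Fin (m + 1),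
      ((fun y => lin i y (a i)) '' {y ∈ cb i a l | lin i y (a i) ∉ W} ∪
      (fun y => lin i y (a i + l)) '' {y ∈ cb i a l | lin i y (a i + l) ∉ W}) := by
    rintro x ⟨⟨hxc, hxo⟩, hxW⟩
    simp only [oc, mem_ofPred_eq, not_forall] at hxo
    obtain ⟨i, hi⟩ := hxo
    rw [mem_iUnion]
    refine ⟨i, ?_⟩
    have hxi := hxc i
    have hcb : (fun j => x (i.succAbove j)) ∈ cb i a l :=
      ⟨fun j => (hxc _).1, fun j => (hxc _).2⟩
    have hlin := lin_ext i x
    by_cases h1 : a i = x i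
    · left
      rw [h1]
      exact ⟨_, ⟨hcb, by rwa [hlin]⟩, hlin⟩
    · have h2 : a i + l = x i := by
        by_contra h2
        exact hi ⟨lt_of_le_of_ne hxi.1 h1, lt_of_le_of_ne hxi.2 (Ne.symm h2)⟩
      right
      rw [h2]
      exact ⟨_, ⟨hcb, by rwa [hlin]⟩, hlin⟩
  calc _ ≤ _ := measure_mono hsub
    _ ≤ ∑ i : Fin (m + 1), _ := measure_iUnion_fintype_le _ _
    _ ≤ ∑ i : Fin (m + 1), 2 * (((m : ℝ≥0∞) + 1) ^ m * V) := by
        apply Finset.sum_le_sum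
        intro i _
        refine (measure_union_le _ _).trans ?_
        rw [two_mul]
        apply add_le_add
        · refine (face_haus _ _ _).trans ?_
          gcongr
          exact hV i _ (Or.inl rfl)
        · refine (face_haus _ _ _).trans ?_
          gcongr
          exact hV i _ (Or.inr rfl)
    _ = _ := by simp; ring

lemma bd_full {m : ℕ} (a : Fin (m + 1) → ℝ) (l : ℝ) (W : Set (EuclideanSpace ℝ (Fin (m + 1)))) :
    μH[(m : ℝ)] ((cc a l \ oc a l) \ W) ≤
      2 * ((m : ℝ≥0∞) + 1) * (((m : ℝ≥0∞) + 1) ^ m * ENNReal.ofReal l ^ m) := by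
  refine bd_haus a W _ fun i b _ => ?_
  rw [← vol_cb i a]
  exact measure_mono fun y hy => hy.1

lemma bd_trace {m : ℕ} {E : Set (EuclideanSpace ℝ (Fin (m + 1)))}
    (hE : MeasurableSet E) (a : Fin (m + 1) → ℝ) {l : ℝ} (hl : 0 < l)
    (hd : ENNReal.ofReal l ^ (m + 1) ≤ 2 ^ (m + 2) * volume (E ∩ oc a l)) :
    μH[(m : ℝ)] ((cc a l \ oc a l) \ mClos E) ≤
      2 * ((m : ℝ≥0∞) + 1) * (((m : ℝ≥0∞) + 1) ^ m * ((1 + 2 ^ (m + 2) * ((m : ℝ≥0∞) + 1)) *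
        μH[(m : ℝ)] (mBdry E ∩ oc a l))) := by
  have hP := poin2 hE a hl hd
  refine bd_haus a _ _ fun i b hb => ?_
  obtain ⟨T, hTm, hTv, hT⟩ := exists_T i hE a l
  set h := μH[(m : ℝ)] (mBdry E ∩ oc a l)
  set ob : Set (Fin m → ℝ) :=
    univ.pi fun j => Ioo (a (i.succAbove j)) (a (i.succAbove j) + l) with hob
  set Z : Set (Fin m → ℝ) := {y | y ∈ ob ∧ ∀ t ∈ Ioo (a i) (a i + l), lin i y t ∉ mClos E} with hZ
  have hZv : volume Z ≤ 2 ^ (m + 2) * ((m : ℝ≥0∞) + 1) * h := by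
    have hL0 : ENNReal.ofReal l ≠ 0 := by simpa using hl
    rw [← ENNReal.mul_le_mul_iff_right hL0 (by simp)]
    refine le_trans ?_ hP
    calc ENNReal.ofReal l * volume Z = volume (Z ×ˢ Ioo (a i) (a i + l)) := by
          rw [Measure.volume_eq_prod, Measure.prod_prod, Real.volume_Ioo, mul_comm]
          congr 2; ring
      _ ≤ volume ((fun p : (Fin m → ℝ) × ℝ => lin i p.1 p.2) ⁻¹'
            (toMeasurable volume (oc a l \ mClos E))) := by
          apply measure_mono
          rintro ⟨y, t⟩ ⟨⟨hy, hyt⟩, ht⟩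
          apply subset_toMeasurable
          refine ⟨fun j => ?_, hyt t ht⟩
          rcases Fin.eq_self_or_eq_succAbove i j with rfl | ⟨j, rfl⟩
          · simpa using ht
          · simpa using hy j (mem_univ _)
      _ = volume (oc a l \ mClos E) := by
          rw [(lin_mp i).measure_preimage (measurableSet_toMeasurable _ _).nullMeasurableSet,
            measure_toMeasurable]
  have hnull : volume (cb i a l \ ob) = 0 := by
    have : ob =ᵐ[volume] cb i a l := by
      rw [hob, cb, volume_pi]
      exact Measure.univ_pi_Ioo_ae_eq_Icc
    exact (ae_le_set.1 this.symm.le)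
  have hsub : {y ∈ cb i a l | lin i y b ∉ mClos E} ⊆ (cb i a l \ ob) ∪ (T ∪ Z) := by
    rintro y ⟨hyc, hyE⟩
    by_cases hyo : y ∈ ob
    · right
      by_cases hyT : y ∈ T
      · exact Or.inl hyT
      right
      refine ⟨hyo, fun t ht => ?_⟩
      have hyo' : ∀ j, a (i.succAbove j) < y j ∧ y j < a (i.succAbove j) + l :=
        fun j => hyo j (mem_univ _)
      have hbB : lin i y b ∉ mBdry E := fun h => hyE h.1
      rcases hb with rfl | rfl
      · have := hT y hyT hyo' (a i) t ht.1.le fun u hu => by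
          rcases eq_or_lt_of_le hu.1 with rfl | hlt
          · exact Or.inr hbB
          · exact Or.inl ⟨hlt, hu.2.trans_lt ht.2⟩
        rwa [← this]
      · have := hT y hyT hyo' t (a i + l) ht.2.le fun u hu => by
          rcases eq_or_lt_of_le hu.2 with rfl | hlt
          · exact Or.inr hbB
          · exact Or.inl ⟨ht.1.trans_le hu.1, hlt⟩
        rwa [this]
    · exact Or.inl ⟨hyc, hyo⟩
  calc _ ≤ _ := measure_mono hsub
    _ ≤ volume (cb i a l \ ob) + (volume T + volume Z) :=
      (measure_union_le _ _).trans (by gcongr; exact measure_union_le _ _)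
    _ ≤ 0 + (h + 2 ^ (m + 2) * ((m : ℝ≥0∞) + 1) * h) := by rw [hnull]; gcongr
    _ = _ := by ring

section dyadic
variable {d : ℕ}

/-- corner -/
noncomputable def da (n : ℤ) (k : Fin d → ℤ) : Fin d → ℝ := fun i => (k i : ℝ) * 2 ^ n

lemma two_zpos (n : ℤ) : (0:ℝ) < 2 ^ n := by positivity

lemma oc_sub (n : ℤ) (k : Fin d → ℤ) : oc (da n k) (2 ^ n) ⊆ dyadCube n k := by
  intro x hx i
  have := hx i
  simp only [da] at this
  exact ⟨this.1.le, by linarith [this.2]⟩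

lemma sub_cc (n : ℤ) (k : Fin d → ℤ) : dyadCube n k ⊆ cc (da n k) (2 ^ n) := by
  intro x hx i
  have := hx i
  simp only [da]
  exact ⟨this.1, by linarith [this.2]⟩

lemma dy_meas (n : ℤ) (k : Fin d → ℤ) : MeasurableSet (dyadCube n k) := by
  have : dyadCube n k = ⋂ i, (({x : EuclideanSpace ℝ (Fin d) | (k i : ℝ) * 2 ^ n ≤ x i}) ∩
      {x | x i < ((k i : ℝ) + 1) * 2 ^ n}) := by
    ext x; simp [dyadCube]
  rw [this]
  refine MeasurableSet.iInter fun i => ?_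
  exact (measurableSet_le (by fun_prop) (by fun_prop)).inter
    (measurableSet_lt (by fun_prop) (by fun_prop))

lemma dy_vol (n : ℤ) (k : Fin d → ℤ) : volume (dyadCube n k) = ENNReal.ofReal (2 ^ n) ^ d := by
  rw [← vol_toLp]
  have : {x : Fin d → ℝ | WithLp.toLp 2 x ∈ dyadCube n k} =
      univ.pi fun i => Ico ((k i : ℝ) * 2 ^ n) (((k i : ℝ) + 1) * 2 ^ n) := by
    ext x; simp [dyadCube, Set.mem_pi]
  rw [this, volume_pi_pi]
  simp only [Real.volume_Ico]
  have : ∀ i : Fin d, ((k i : ℝ) + 1) * 2 ^ n - (k i : ℝ) * 2 ^ n = 2 ^ n := fun i => by ring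
  simp [this]

lemma oc_vol (a : Fin d → ℝ) (l : ℝ) : volume (oc a l) = ENNReal.ofReal l ^ d := by
  rw [← vol_toLp]
  have : {x : Fin d → ℝ | WithLp.toLp 2 x ∈ oc a l} =
      univ.pi fun i => Ioo (a i) (a i + l) := by
    ext x; simp [oc, Set.mem_pi]
  rw [this, volume_pi_pi]
  simp

lemma dy_diff (n : ℤ) (k : Fin d → ℤ) : volume (dyadCube n k \ oc (da n k) (2 ^ n)) = 0 := by
  rw [measure_sdiff (oc_sub n k) (oc_open _ _).measurableSet.nullMeasurableSet, dy_vol, oc_vol,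
    tsub_self]
  rw [oc_vol]; exact ENNReal.pow_ne_top (by simp)

lemma dy_inter (E : Set (EuclideanSpace ℝ (Fin d))) (n : ℤ) (k : Fin d → ℤ) :
    volume (E ∩ oc (da n k) (2 ^ n)) = volume (E ∩ dyadCube n k) := by
  apply le_antisymm
  · exact measure_mono (inter_subset_inter_right _ (oc_sub n k))
  · calc volume (E ∩ dyadCube n k) ≤ volume ((E ∩ oc (da n k) (2 ^ n)) ∪
          (dyadCube n k \ oc (da n k) (2 ^ n))) := by
          apply measure_mono
          rintro x ⟨h1, h2⟩
          by_cases h : x ∈ oc (da n k) (2 ^ n)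
          · exact Or.inl ⟨h1, h⟩
          · exact Or.inr ⟨h2, h⟩
      _ ≤ _ := measure_union_le _ _
      _ = _ := by rw [dy_diff, add_zero]

lemma dy_arith {n : ℤ} {s : ℕ} {p p' : ℤ} {x : ℝ} (h1 : (p:ℝ) * 2 ^ n ≤ x)
    (h2 : x < ((p:ℝ) + 1) * 2 ^ n) (h3 : (p':ℝ) * 2 ^ (n + s) ≤ x)
    (h4 : x < ((p':ℝ) + 1) * 2 ^ (n + s)) : p' * 2 ^ s ≤ p ∧ p + 1 ≤ (p' + 1) * 2 ^ s := by
  have e : (2:ℝ) ^ (n + s) = 2 ^ s * 2 ^ n := by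
    rw [zpow_add₀ two_ne_zero, zpow_natCast]; ring
  have hp := two_zpos n
  rw [e] at h3 h4
  constructor
  · have : (p':ℝ) * 2 ^ s < p + 1 := by
      have := h3.trans_lt h2
      rw [← mul_assoc] at this
      exact lt_of_mul_lt_mul_right this hp.le
    have : p' * 2 ^ s < p + 1 := by exact_mod_cast this
    omega
  · have : (p:ℝ) < (p' + 1) * 2 ^ s := by
      have := h1.trans_lt h4
      rw [← mul_assoc] at this
      exact lt_of_mul_lt_mul_right this hp.le
    have : p < (p' + 1) * 2 ^ s := by exact_mod_cast this
    omega

lemma dy_nest {n n' : ℤ} (hn : n ≤ n') {k k' : Fin d → ℤ} {x : EuclideanSpace ℝ (Fin d)}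
    (hx : x ∈ dyadCube n k) (hx' : x ∈ dyadCube n' k') : dyadCube n k ⊆ dyadCube n' k' := by
  obtain ⟨s, rfl⟩ := Int.le.dest hn
  intro y hy i
  obtain ⟨h1, h2⟩ := dy_arith (hx i).1 (hx i).2 (hx' i).1 (hx' i).2
  have e : (2:ℝ) ^ (n + s) = 2 ^ s * 2 ^ n := by
    rw [zpow_add₀ two_ne_zero, zpow_natCast]; ring
  have hp := two_zpos n
  have h1' : (k' i : ℝ) * 2 ^ s ≤ k i := by exact_mod_cast h1
  have h2' : (k i : ℝ) + 1 ≤ (k' i + 1) * 2 ^ s := by exact_mod_cast h2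
  rw [e, ← mul_assoc, ← mul_assoc]
  exact ⟨le_trans (by gcongr) (hy i).1, lt_of_lt_of_le (hy i).2 (by gcongr)⟩

lemma dy_eq {n : ℤ} {k k' : Fin d → ℤ} {x : EuclideanSpace ℝ (Fin d)}
    (hx : x ∈ dyadCube n k) (hx' : x ∈ dyadCube n k') : k = k' := by
  ext i
  have := dy_arith (s := 0) (hx i).1 (hx i).2 (by simpa using (hx' i).1) (by simpa using (hx' i).2)
  simp only [pow_zero, mul_one] at this
  omega

lemma dy_mem (n : ℤ) (x : EuclideanSpace ℝ (Fin d)) :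
    x ∈ dyadCube n (fun i => ⌊x i / 2 ^ n⌋) := by
  intro i
  have hp := two_zpos n
  constructor
  · rw [← le_div_iff₀ hp]; exact Int.floor_le _
  · rw [← div_lt_iff₀ hp]; exact Int.lt_floor_add_one _

lemma dy_diam {n : ℤ} {k : Fin d → ℤ} {x y : EuclideanSpace ℝ (Fin d)}
    (hx : x ∈ cc (da n k) (2 ^ n)) (hy : y ∈ cc (da n k) (2 ^ n)) : dist x y ≤ d * 2 ^ n :=
  distE_le x y (two_zpos n).le fun i => by
    have h1 := hx i
    have h2 := hy i
    rw [abs_le]; constructor <;> linarith [h1.1, h1.2, h2.1, h2.2]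

/-- maximal members -/
def maxF (F : Set (ℤ × (Fin d → ℤ))) : Set (ℤ × (Fin d → ℤ)) :=
  {p | p ∈ F ∧ ∀ q ∈ F, p.1 < q.1 → Disjoint (dyadCube p.1 p.2) (dyadCube q.1 q.2)}

lemma maxF_cover {F : Set (ℤ × (Fin d → ℤ))} {N : ℤ} (hN : ∀ p ∈ F, p.1 ≤ N)
    {p : ℤ × (Fin d → ℤ)} (hp : p ∈ F) :
    ∃ q ∈ maxF F, dyadCube p.1 p.2 ⊆ dyadCube q.1 q.2 := by
  obtain ⟨n, ⟨q, hqF, hqs, rfl⟩, hmax⟩ := Int.exists_greatest_of_bdd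
    (P := fun n => ∃ q ∈ F, dyadCube p.1 p.2 ⊆ dyadCube q.1 q.2 ∧ q.1 = n)
    ⟨N, by rintro n ⟨q, hq, -, rfl⟩; exact hN q hq⟩ ⟨p.1, p, hp, subset_rfl, rfl⟩
  refine ⟨q, ⟨hqF, fun r hr hlt => ?_⟩, hqs⟩
  by_contra hd
  rw [not_disjoint_iff] at hd
  obtain ⟨x, h1, h2⟩ := hd
  have := hmax r.1 ⟨r, hr, hqs.trans (dy_nest hlt.le h1 h2), rfl⟩
  omega

lemma maxF_disj {F : Set (ℤ × (Fin d → ℤ))} {p q : ℤ × (Fin d → ℤ)} (hp : p ∈ maxF F)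
    (hq : q ∈ maxF F) (hne : p ≠ q) : Disjoint (dyadCube p.1 p.2) (dyadCube q.1 q.2) := by
  rcases lt_trichotomy p.1 q.1 with h | h | h
  · exact hp.2 q hq.1 h
  · by_contra hd
    rw [not_disjoint_iff] at hd
    obtain ⟨x, h1, h2⟩ := hd
    rw [← h] at h2
    exact hne (Prod.ext h (dy_eq h1 h2))
  · exact (hq.2 p hp.1 h).symm

lemma maxF_sum_le (F : Set (ℤ × (Fin d → ℤ))) (μ : Measure (EuclideanSpace ℝ (Fin d)))
    (S A : Set (EuclideanSpace ℝ (Fin d)))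
    (hS : ∀ p ∈ maxF F, oc (da p.1 p.2) (2 ^ p.1) ⊆ S) :
    ∑' p : maxF F, μ (A ∩ oc (da p.1.1 p.1.2) (2 ^ p.1.1)) ≤ μ (A ∩ S) := by
  have h1 : ∀ p : maxF F, μ (A ∩ oc (da p.1.1 p.1.2) (2 ^ p.1.1)) =
      (μ.restrict A) (oc (da p.1.1 p.1.2) (2 ^ p.1.1)) := fun p => by
    rw [Measure.restrict_apply (oc_open _ _).measurableSet, inter_comm]
  simp_rw [h1]
  rw [← measure_iUnion]
  · rw [Measure.restrict_apply (MeasurableSet.iUnion fun p => (oc_open _ _).measurableSet), inter_comm]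
    apply measure_mono
    apply inter_subset_inter_right
    exact iUnion_subset fun p => hS p.1 p.2
  · intro p q hpq
    exact (maxF_disj p.2 q.2 (fun h => hpq (Subtype.ext h))).mono (oc_sub _ _) (oc_sub _ _)
  · exact fun p => (oc_open _ _).measurableSet

/-- density one points lie in dense small dyadic cubes -/
lemma dy_dense {E : Set (EuclideanSpace ℝ (Fin d))} (hE : MeasurableSet E)
    {x : EuclideanSpace ℝ (Fin d)} (hx : x ∉ mClos Eᶜ) {lam : ℝ} (hlam : 0 ≤ lam) (hl1 : lam < 1) :
    ∃ n0 : ℤ, ∀ n ≤ n0, ∀ k, x ∈ dyadCube n k →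
      ENNReal.ofReal lam * volume (dyadCube n k) < volume (E ∩ dyadCube n k) := by
  set K : ℝ := (d : ℝ) + 1 with hK
  have hKp : 0 < K := by positivity
  obtain ⟨δ, hδ, H⟩ := nm_mClos.1 hx ((1 - lam) / 2 / K ^ d) (by
    have : 0 < 1 - lam := by linarith
    positivity)
  obtain ⟨j, hj⟩ := exists_pow_lt_of_lt_one (show 0 < δ / K by positivity)
    (show (1/2 : ℝ) < 1 by norm_num)
  refine ⟨-j, fun n hn k hxk => ?_⟩
  have h2 : (2:ℝ) ^ n < δ / K := by
    refine lt_of_le_of_lt ?_ hj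
    calc (2:ℝ) ^ n ≤ 2 ^ (-(j:ℤ)) := zpow_le_zpow_right₀ (by norm_num) hn
      _ = _ := by rw [zpow_neg, zpow_natCast, one_div, inv_pow]
  have hp := two_zpos n
  rw [lt_div_iff₀ hKp] at h2
  have h3 := H (2 ^ n * K) (by positivity) h2
  have h4 : dyadCube n k ⊆ ball x (2 ^ n * K) := fun y hy => by
    rw [mem_ball]
    have := dy_diam (sub_cc _ _ hy) (sub_cc _ _ hxk)
    rw [hK]; nlinarith
  have e : (1 - lam) / 2 / K ^ d * (2 ^ n * K) ^ d = (1 - lam) / 2 * (2 ^ n) ^ d := by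
    rw [mul_pow]; field_simp
  rw [e] at h3
  have h5 : volume (dyadCube n k) ≤ volume (E ∩ dyadCube n k) +
      ENNReal.ofReal ((1 - lam) / 2 * (2 ^ n) ^ d) := by
    refine le_trans ?_ (add_le_add le_rfl h3)
    refine le_trans (measure_mono ?_) (measure_union_le _ _)
    intro y hy
    by_cases hyE : y ∈ E
    · exact Or.inl ⟨hyE, hy⟩
    · exact Or.inr ⟨h4 hy, hyE⟩
  by_contra hcon
  rw [not_lt] at hcon
  have h6 := h5.trans (add_le_add hcon le_rfl)
  rw [dy_vol, ← ENNReal.ofReal_pow hp.le, ← ENNReal.ofReal_mul hlam,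
    ← ENNReal.ofReal_add (by positivity) (by
      have : 0 < 1 - lam := by linarith
      positivity), ENNReal.ofReal_le_ofReal_iff (by
      have : 0 < 1 - lam := by linarith
      positivity)] at h6
  have : (0:ℝ) < (2 ^ n) ^ d := by positivity
  nlinarith
end dyadic

lemma dy_coord {d : ℕ} {n n' : ℤ} {k k' : Fin d → ℤ} (h : dyadCube n k ⊆ dyadCube n' k') (i : Fin d) :
    (k' i : ℝ) * 2 ^ n' ≤ (k i : ℝ) * 2 ^ n ∧
    ((k i : ℝ) + 1) * 2 ^ n ≤ ((k' i : ℝ) + 1) * 2 ^ n' := by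
  have hp := two_zpos n
  have key : ∀ s : ℝ, 0 ≤ s → s < 2 ^ n →
      (WithLp.toLp 2 (fun j => (k j : ℝ) * 2 ^ n + s) : EuclideanSpace ℝ (Fin d)) ∈ dyadCube n k := by
    intro s h0 h1 j
    constructor
    · show (k j : ℝ) * 2 ^ n ≤ (k j : ℝ) * 2 ^ n + s
      linarith
    · show (k j : ℝ) * 2 ^ n + s < _
      linarith
  constructor
  · have := (h (key 0 le_rfl hp) i).1
    change _ ≤ (k i : ℝ) * 2 ^ n + 0 at this
    linarith
  · apply le_of_forall_lt
    intro c hc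
    have := (h (key (max (c - k i * 2 ^ n) 0) (le_max_right _ _)
      (max_lt (by linarith) hp)) i).2
    change (k i : ℝ) * 2 ^ n + _ < _ at this
    linarith [le_max_left (c - k i * 2 ^ n) 0]

lemma dy_oc_mono {d : ℕ} {n n' : ℤ} {k k' : Fin d → ℤ} (h : dyadCube n k ⊆ dyadCube n' k') :
    oc (da n k) (2 ^ n) ⊆ oc (da n' k') (2 ^ n') := by
  intro x hx i
  have h1 := dy_coord h i
  have h2 := hx i
  simp only [da] at h2 ⊢
  constructor <;> linarith [h1.1, h1.2, h2.1, h2.2]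

lemma dy_cc_mono {d : ℕ} {n n' : ℤ} {k k' : Fin d → ℤ} (h : dyadCube n k ⊆ dyadCube n' k') :
    cc (da n k) (2 ^ n) ⊆ cc (da n' k') (2 ^ n') := by
  intro x hx i
  have h1 := dy_coord h i
  have h2 := hx i
  simp only [da] at h2 ⊢
  constructor <;> linarith [h1.1, h1.2, h2.1, h2.2]

/-- l^(m+1) sums versus l^m sums -/
lemma sum_pow {ι : Type*} (m : ℕ) (l : ι → ℝ≥0∞) (mu L : ℝ≥0∞)
    (h0 : mu * L ≠ 0) (hS : ∑' j, l j ^ (m + 1) ≠ ⊤)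
    (h : (mu * L) ^ (m + 1) ≤ ∑' j, l j ^ (m + 1)) :
    (mu * L) ^ m ≤ ∑' j, l j ^ m := by
  set S := ∑' j, l j ^ (m + 1) with hSd
  set s : ℝ≥0∞ := S ^ (1 / ((m:ℝ) + 1)) with hs
  have e : s ^ (m + 1) = S := by
    rw [hs, ← ENNReal.rpow_natCast, ← ENNReal.rpow_mul]
    push_cast
    rw [one_div_mul_cancel (by positivity), ENNReal.rpow_one]
  have hle : ∀ a b : ℝ≥0∞, a ^ (m + 1) ≤ b ^ (m + 1) → a ≤ b := fun a b hab =>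
    (ENNReal.pow_le_pow_left_iff (by omega)).1 hab
  have h1 : mu * L ≤ s := hle _ _ (by rw [e]; exact h)
  have hs0 : s ≠ 0 := fun hh => h0 (le_antisymm (hh ▸ h1) (by simp))
  have hst : s ≠ ⊤ := by
    intro hh; apply hS; rw [← e, hh]; simp
  have h2 : ∀ j, l j ≤ s := fun j => hle _ _ (by rw [e]; exact ENNReal.le_tsum j)
  have h3 : s ^ m * s ≤ (∑' j, l j ^ m) * s := by
    rw [← pow_succ, e, hSd, ← ENNReal.tsum_mul_right]
    refine ENNReal.tsum_le_tsum fun j => ?_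
    rw [pow_succ]
    exact mul_le_mul_right (h2 j) _
  have h4 : s ^ m ≤ ∑' j, l j ^ m := (ENNReal.mul_le_mul_iff_left hs0 hst).1 h3
  exact le_trans (by gcongr) h4

lemma cube_small {m : ℕ} {E : Set (EuclideanSpace ℝ (Fin (m + 1)))} (hE : MeasurableSet E)
    (n : ℤ) (k : Fin (m + 1) → ℤ) {lam : ℝ} (h0 : 0 < lam)
    (hd : ENNReal.ofReal lam * volume (dyadCube n k) < volume (E ∩ dyadCube n k))
    (hs : 2 ^ (m + 2) * volume (E ∩ dyadCube n k) < volume (dyadCube n k)) :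
    ENNReal.ofReal (lam ^ (1 / ((m:ℝ) + 1))) ^ m * ENNReal.ofReal (2 ^ n) ^ m ≤
      2 * (2 ^ (m + 2) * ((m:ℝ≥0∞) + 1)) * μH[(m:ℝ)] (mBdry E ∩ oc (da n k) (2 ^ n)) := by
  set F : Set (ℤ × (Fin (m + 1) → ℤ)) := {p | p.1 ≤ n ∧ dyadCube p.1 p.2 ⊆ dyadCube n k ∧
    volume (dyadCube p.1 p.2) ≤ 2 ^ (m + 2) * volume (E ∩ dyadCube p.1 p.2)} with hF
  have hFn : ∀ p ∈ F, p.1 ≤ n := fun p hp => hp.1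
  have hoc : ∀ p ∈ maxF F, oc (da p.1 p.2) (2 ^ p.1) ⊆ oc (da n k) (2 ^ n) :=
    fun p hp => dy_oc_mono hp.1.2.1
  -- each maximal cube
  have hiso : ∀ p ∈ maxF F, ENNReal.ofReal (2 ^ p.1) ^ m ≤
      2 * (2 ^ (m + 2) * ((m:ℝ≥0∞) + 1)) * μH[(m:ℝ)] (mBdry E ∩ oc (da p.1 p.2) (2 ^ p.1)) := by
    rintro ⟨n1, k1⟩ hp
    have hp1 := hp.1
    obtain ⟨hn1, hsub, hden⟩ := hp1
    simp only at hn1 hsub hden ⊢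
    have hx : (WithLp.toLp 2 (da n1 k1) : EuclideanSpace ℝ (Fin (m + 1))) ∈ dyadCube n1 k1 := by
      intro i
      have := two_zpos n1
      refine ⟨le_rfl, ?_⟩
      show (k1 i : ℝ) * 2 ^ n1 < _
      linarith
    set x : EuclideanSpace ℝ (Fin (m + 1)) := WithLp.toLp 2 (da n1 k1) with hxd
    have hlt : n1 < n := by
      rcases hn1.lt_or_eq with h | h
      · exact h
      · subst h
        have := dy_eq hx (hsub hx)
        subst this
        exact absurd hden (not_le.2 hs)
    have hxq := dy_mem (n1 + 1) x
    set q : Fin (m + 1) → ℤ := fun i => ⌊x i / 2 ^ (n1 + 1)⌋ with hq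
    have hpq : dyadCube n1 k1 ⊆ dyadCube (n1 + 1) q := dy_nest (by omega) hx hxq
    have hqQ : dyadCube (n1 + 1) q ⊆ dyadCube n k := dy_nest (by omega) hxq (hsub hx)
    have hnd : ¬ volume (dyadCube (n1 + 1) q) ≤ 2 ^ (m + 2) * volume (E ∩ dyadCube (n1 + 1) q) := by
      intro hh
      have := hp.2 (n1 + 1, q) ⟨by simpa using hlt, hqQ, hh⟩ (by simp)
      exact (Set.disjoint_left.1 this) hx hxq
    have hfin : ENNReal.ofReal (2 ^ n1) ^ (m + 1) ≠ ⊤ := ENNReal.pow_ne_top (by simp)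
    have hV : 2 * volume (E ∩ dyadCube n1 k1) ≤ ENNReal.ofReal (2 ^ n1) ^ (m + 1) := by
      have h1 : 2 ^ (m + 2) * volume (E ∩ dyadCube n1 k1) ≤
          2 ^ (m + 1) * ENNReal.ofReal (2 ^ n1) ^ (m + 1) := by
        calc 2 ^ (m + 2) * volume (E ∩ dyadCube n1 k1)
            ≤ 2 ^ (m + 2) * volume (E ∩ dyadCube (n1 + 1) q) := by gcongr
          _ ≤ volume (dyadCube (n1 + 1) q) := (not_le.1 hnd).le
          _ = _ := by
            rw [dy_vol, zpow_add_one₀ two_ne_zero, ENNReal.ofReal_mul (two_zpos n1).le, mul_pow,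
              mul_comm]; simp
      rw [pow_succ (2:ℝ≥0∞) (m + 1), mul_assoc] at h1
      exact (ENNReal.mul_le_mul_iff_right (by simp) (by simp)).1 h1
    apply iso_mid hE _ (two_zpos n1)
    · rw [dy_inter, ← dy_vol n1 k1]; exact hden
    · rw [← dy_inter] at hV
      have h2 : ENNReal.ofReal (2 ^ n1) ^ (m + 1) = volume (E ∩ oc (da n1 k1) (2 ^ n1)) +
          volume (oc (da n1 k1) (2 ^ n1) \ E) := by
        rw [← oc_vol (da n1 k1) (2 ^ n1), inter_comm]
        exact (measure_inter_add_sdiff _ hE).symm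
      have h3 : ENNReal.ofReal (2 ^ n1) ^ (m + 1) + ENNReal.ofReal (2 ^ n1) ^ (m + 1) ≤
          ENNReal.ofReal (2 ^ n1) ^ (m + 1) + 2 * volume (oc (da n1 k1) (2 ^ n1) \ E) := by
        rw [← two_mul]
        conv_lhs => rw [h2]
        rw [mul_add]
        gcongr
      exact (ENNReal.add_le_add_iff_left hfin).1 h3
  -- volume
  have hvol : volume (E ∩ dyadCube n k) ≤ ∑' p : maxF F, ENNReal.ofReal (2 ^ p.1.1) ^ (m + 1) := by
    have hn0 : volume (E ∩ mClos Eᶜ) = 0 := by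
      have := ae_mClos hE.compl
      rwa [compl_compl] at this
    calc volume (E ∩ dyadCube n k) ≤ volume ((E ∩ mClos Eᶜ) ∪
          ⋃ p : maxF F, dyadCube p.1.1 p.1.2) := by
          apply measure_mono
          rintro x ⟨hxE, hxQ⟩
          by_cases hx : x ∈ mClos Eᶜ
          · exact Or.inl ⟨hxE, hx⟩
          right
          obtain ⟨n0, H⟩ := dy_dense hE hx (lam := 1 / 2 ^ (m + 2)) (by positivity) (by
            rw [div_lt_one (by positivity)]
            exact one_lt_pow₀ (by norm_num) (by omega))
          have hm := dy_mem (min n0 n) x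
          have H1 := H (min n0 n) (min_le_left _ _) _ hm
          have hF1 : (min n0 n, fun i => ⌊x i / 2 ^ (min n0 n)⌋) ∈ F := by
            refine ⟨min_le_right _ _, dy_nest (min_le_right _ _) hm hxQ, ?_⟩
            have h2 : (2:ℝ≥0∞) ^ (m + 2) * ENNReal.ofReal (1 / 2 ^ (m + 2)) = 1 := by
              rw [one_div, ENNReal.ofReal_inv_of_pos (by positivity), ENNReal.ofReal_pow (by norm_num)]
              simp only [ENNReal.ofReal_ofNat]
              exact ENNReal.mul_inv_cancel (by simp) (by simp)
            calc _ = (2:ℝ≥0∞) ^ (m + 2) * (ENNReal.ofReal (1 / 2 ^ (m + 2)) *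
                  volume (dyadCube (min n0 n) fun i => ⌊x i / 2 ^ (min n0 n)⌋)) := by
                    rw [← mul_assoc, h2, one_mul]
              _ ≤ _ := by gcongr
          obtain ⟨q, hq, hsub⟩ := maxF_cover hFn hF1
          exact mem_iUnion.2 ⟨⟨q, hq⟩, hsub hm⟩
      _ ≤ _ := measure_union_le _ _
      _ ≤ 0 + ∑' p : maxF F, volume (dyadCube p.1.1 p.1.2) := by
          gcongr
          · exact hn0.le
          · exact measure_iUnion_le _
      _ = _ := by simp [dy_vol]
  have hfinS : ∑' p : maxF F, ENNReal.ofReal (2 ^ p.1.1) ^ (m + 1) ≠ ⊤ := by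
    have := maxF_sum_le F volume _ univ hoc
    simp only [univ_inter, oc_vol] at this
    exact ne_top_of_le_ne_top (ENNReal.pow_ne_top (by simp)) this
  have hmu : ENNReal.ofReal (lam ^ (1 / ((m:ℝ) + 1))) ^ (m + 1) = ENNReal.ofReal lam := by
    rw [← ENNReal.ofReal_pow (by positivity), ← Real.rpow_natCast, ← Real.rpow_mul h0.le]
    push_cast
    rw [one_div_mul_cancel (by positivity), Real.rpow_one]
  have h1 := sum_pow m (fun p : maxF F => ENNReal.ofReal (2 ^ p.1.1))
    (ENNReal.ofReal (lam ^ (1 / ((m:ℝ) + 1)))) (ENNReal.ofReal (2 ^ n)) (by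
      have := Real.rpow_pos_of_pos h0 (1 / ((m:ℝ) + 1))
      have h2 := two_zpos n
      simp only [ne_eq, mul_eq_zero, ENNReal.ofReal_eq_zero, not_or, not_le]
      exact ⟨this, h2⟩) hfinS (by
      rw [mul_pow, hmu, ← dy_vol n k]
      exact hd.le.trans hvol)
  rw [← mul_pow]
  refine h1.trans ?_
  calc _ ≤ ∑' p : maxF F, 2 * (2 ^ (m + 2) * ((m:ℝ≥0∞) + 1)) *
        μH[(m:ℝ)] (mBdry E ∩ oc (da p.1.1 p.1.2) (2 ^ p.1.1)) :=
        ENNReal.tsum_le_tsum fun p => hiso p.1 p.2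
    _ = 2 * (2 ^ (m + 2) * ((m:ℝ≥0∞) + 1)) * ∑' p : maxF F,
        μH[(m:ℝ)] (mBdry E ∩ oc (da p.1.1 p.1.2) (2 ^ p.1.1)) := ENNReal.tsum_mul_left
    _ ≤ _ := by
        gcongr
        exact maxF_sum_le F _ _ _ hoc

/-- the constant -/
noncomputable def CC (m : ℕ) : ℝ≥0∞ :=
  2 * ((m:ℝ≥0∞) + 1) * (((m:ℝ≥0∞) + 1) ^ m * (1 + 2 * (2 ^ (m + 2) * ((m:ℝ≥0∞) + 1))))

lemma CC_top (m : ℕ) : CC m ≠ ⊤ := by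
  unfold CC
  have : ((m:ℝ≥0∞) + 1) ≠ ⊤ := by simp
  refine ENNReal.mul_ne_top (ENNReal.mul_ne_top (by simp) this)
    (ENNReal.mul_ne_top (ENNReal.pow_ne_top this) (ENNReal.add_ne_top.2 ⟨by simp,
      ENNReal.mul_ne_top (by simp) (ENNReal.mul_ne_top (by simp) this)⟩))

lemma lam_ge {m : ℕ} {lam : ℝ} (h0 : 0 < lam) (h1 : lam < 1) :
    1 ≤ ENNReal.ofReal (lam ^ (-(m:ℝ) / ((m:ℝ) + 1))) := by
  rw [ENNReal.one_le_ofReal]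
  apply Real.one_le_rpow_of_pos_of_le_one_of_nonpos h0 h1.le
  exact div_nonpos_of_nonpos_of_nonneg (by simp) (by positivity)

lemma cube_bd {m : ℕ} {E : Set (EuclideanSpace ℝ (Fin (m + 1)))} (hE : MeasurableSet E)
    (n : ℤ) (k : Fin (m + 1) → ℤ) {lam : ℝ} (h0 : 0 < lam) (h1 : lam < 1)
    (hd : ENNReal.ofReal lam * volume (dyadCube n k) < volume (E ∩ dyadCube n k)) :
    μH[(m:ℝ)] ((cc (da n k) (2 ^ n) \ oc (da n k) (2 ^ n)) \ mClos E) ≤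
      CC m * ENNReal.ofReal (lam ^ (-(m:ℝ) / ((m:ℝ) + 1))) *
        μH[(m:ℝ)] (mBdry E ∩ oc (da n k) (2 ^ n)) := by
  set A := ENNReal.ofReal (lam ^ (-(m:ℝ) / ((m:ℝ) + 1))) with hA
  set H := μH[(m:ℝ)] (mBdry E ∩ oc (da n k) (2 ^ n)) with hH
  have hA1 : 1 ≤ A := lam_ge h0 h1
  by_cases hs : volume (dyadCube n k) ≤ 2 ^ (m + 2) * volume (E ∩ dyadCube n k)
  · have := bd_trace hE (da n k) (two_zpos n) (by
      rw [dy_inter, ← dy_vol n k]; exact hs)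
    refine this.trans ?_
    calc _ = 2 * ((m:ℝ≥0∞) + 1) * (((m:ℝ≥0∞) + 1) ^ m * (1 + 1 * (2 ^ (m + 2) * ((m:ℝ≥0∞) + 1)))) *
          1 * H := by ring
      _ ≤ _ := by
          unfold CC
          gcongr
          norm_num
  · have h2 := cube_small hE n k h0 hd (not_le.1 hs)
    have e : A * ENNReal.ofReal (lam ^ (1 / ((m:ℝ) + 1))) ^ m = 1 := by
      rw [hA, ← ENNReal.ofReal_pow (by positivity), ← ENNReal.ofReal_mul (by positivity),
        ← Real.rpow_natCast, ← Real.rpow_mul h0.le, ← Real.rpow_add h0]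
      have : -(m:ℝ) / ((m:ℝ) + 1) + 1 / ((m:ℝ) + 1) * m = 0 := by
        field_simp; ring
      rw [this]; simp
    have h3 : ENNReal.ofReal (2 ^ n) ^ m ≤ A * (2 * (2 ^ (m + 2) * ((m:ℝ≥0∞) + 1)) * H) := by
      calc _ = A * (ENNReal.ofReal (lam ^ (1 / ((m:ℝ) + 1))) ^ m * ENNReal.ofReal (2 ^ n) ^ m) := by
            rw [← mul_assoc, e, one_mul]
        _ ≤ _ := by gcongr
    refine (bd_full (da n k) (2 ^ n) _).trans ?_
    calc _ ≤ 2 * ((m:ℝ≥0∞) + 1) * (((m:ℝ≥0∞) + 1) ^ m *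
          (A * (2 * (2 ^ (m + 2) * ((m:ℝ≥0∞) + 1)) * H))) := by gcongr
      _ = 2 * ((m:ℝ≥0∞) + 1) * (((m:ℝ≥0∞) + 1) ^ m *
          (0 + 2 * (2 ^ (m + 2) * ((m:ℝ≥0∞) + 1)))) * A * H := by ring
      _ ≤ _ := by
          unfold CC
          gcongr
          simp

section topo
variable {d : ℕ}

/-- good cubes -/
def GG (Ω E : Set (EuclideanSpace ℝ (Fin d))) (lam : ℝ) : Set (ℤ × (Fin d → ℤ)) :=
  {p | dyadCube p.1 p.2 ⊆ Ω ∧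
    ENNReal.ofReal lam * volume (dyadCube p.1 p.2) < volume (E ∩ dyadCube p.1 p.2)}

lemma U_iff (Ω E : Set (EuclideanSpace ℝ (Fin d))) (lam : ℝ) (x : EuclideanSpace ℝ (Fin d)) :
    x ∈ {x ∈ Ω | ENNReal.ofReal lam < dyadMax Ω E x} ↔
      ∃ p ∈ GG Ω E lam, x ∈ dyadCube p.1 p.2 := by
  have hv : ∀ (n : ℤ) (k : Fin d → ℤ), volume (dyadCube n k) ≠ 0 ∧ volume (dyadCube n k) ≠ ⊤ := by
    intro n k
    rw [dy_vol]
    refine ⟨?_, ENNReal.pow_ne_top (by simp)⟩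
    have := two_zpos n
    apply pow_ne_zero
    simp [this]
  simp only [mem_sep_iff, dyadMax, lt_iSup_iff, GG, mem_ofPred_eq]
  constructor
  · rintro ⟨-, n, k, hx, hs, h⟩
    refine ⟨(n, k), ⟨hs, ?_⟩, hx⟩
    exact (ENNReal.lt_div_iff_mul_lt (Or.inl (hv n k).1) (Or.inl (hv n k).2)).1 h
  · rintro ⟨⟨n, k⟩, ⟨hs, h⟩, hx⟩
    exact ⟨hs hx, n, k, hx, hs,
      (ENNReal.lt_div_iff_mul_lt (Or.inl (hv n k).1) (Or.inl (hv n k).2)).2 h⟩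

lemma gap1 (t : ℝ) {w : ℝ} (hw : 0 < w) :
    ∃ r0 : ℝ, 0 < r0 ∧ ∀ j : ℤ, (j * w < t → r0 ≤ t - j * w) ∧ (t < j * w → r0 ≤ j * w - t) := by
  refine ⟨min (t - (⌈t / w⌉ - 1 : ℤ) * w) ((⌊t / w⌋ + 1 : ℤ) * w - t), ?_, fun j => ⟨fun h => ?_, fun h => ?_⟩⟩
  · apply lt_min
    · have h : ((⌈t / w⌉ - 1 : ℤ) : ℝ) < t / w := Int.lt_ceil.1 (by omega)
      rw [lt_div_iff₀ hw] at h
      linarith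
    · have h : t / w < ((⌊t / w⌋ + 1 : ℤ) : ℝ) := Int.floor_lt.1 (by omega)
      rw [div_lt_iff₀ hw] at h
      linarith
  · refine (min_le_left _ _).trans ?_
    rw [← lt_div_iff₀ hw] at h
    have h2 := Int.lt_ceil.2 h
    have h3 : (j : ℝ) ≤ ((⌈t / w⌉ - 1 : ℤ) : ℝ) := by exact_mod_cast (by omega)
    nlinarith
  · refine (min_le_right _ _).trans ?_
    rw [← div_lt_iff₀ hw] at h
    have h2 := Int.floor_lt.2 h
    have h3 : ((⌊t / w⌋ + 1 : ℤ) : ℝ) ≤ (j : ℝ) := by exact_mod_cast (by omega)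
    nlinarith

lemma gapd (x : EuclideanSpace ℝ (Fin d)) {w : ℝ} (hw : 0 < w) :
    ∃ r0 : ℝ, 0 < r0 ∧ ∀ (i : Fin d) (j : ℤ),
      (j * w < x i → r0 ≤ x i - j * w) ∧ (x i < j * w → r0 ≤ j * w - x i) := by
  have h : ∀ᶠ r in nhdsWithin (0:ℝ) (Ioi 0), ∀ (i : Fin d), ∀ (j : ℤ),
      (j * w < x i → r ≤ x i - j * w) ∧ (x i < j * w → r ≤ j * w - x i) := by
    rw [eventually_all]
    intro i
    obtain ⟨r0, h0, H⟩ := gap1 (x i) hw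
    filter_upwards [Ioo_mem_nhdsGT h0] with r hr j
    exact ⟨fun h => hr.2.le.trans ((H j).1 h), fun h => hr.2.le.trans ((H j).2 h)⟩
  obtain ⟨r, h1, h2⟩ := (h.and self_mem_nhdsWithin).exists
  exact ⟨r, h2, h1⟩

lemma small_zpow {δ : ℝ} (hδ : 0 < δ) : ∃ n : ℤ, (2:ℝ) ^ n < δ := by
  obtain ⟨j, hj⟩ := exists_pow_lt_of_lt_one hδ (show (1/2 : ℝ) < 1 by norm_num)
  refine ⟨-j, ?_⟩
  rwa [zpow_neg, zpow_natCast, ← inv_pow, ← one_div]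

lemma coord_dist (x y : EuclideanSpace ℝ (Fin d)) (i : Fin d) : |x i - y i| ≤ dist x y := by
  have := PiLp.norm_apply_le (x - y) i
  rw [dist_eq_norm]
  simpa using this

lemma near_cube {Ω E : Set (EuclideanSpace ℝ (Fin d))}
    {lam : ℝ} (h0 : 0 < lam) {x : EuclideanSpace ℝ (Fin d)}
    (hxE : x ∉ mClos E)
    (hU : x ∈ mClos {x ∈ Ω | ENNReal.ofReal lam < dyadMax Ω E x}) :
    ∃ p ∈ GG Ω E lam, x ∈ cc (da p.1 p.2) (2 ^ p.1) := by
  by_contra hcon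
  push Not at hcon
  refine absurd hU (nm_mClos.2 ?_)
  set K : ℝ := (d : ℝ) + 2 with hK
  have hKp : 0 < K := by positivity
  obtain ⟨δ0, hδ0, H0⟩ := nm_mClos.1 hxE (lam / K ^ d) (by positivity)
  obtain ⟨n0, hn0⟩ := small_zpow (show 0 < δ0 / K by positivity)
  rw [lt_div_iff₀ hKp] at hn0
  obtain ⟨r0, hr0, Hr0⟩ := gapd x (two_zpos n0)
  -- size control
  have hsize : ∀ r, 0 < r → r < r0 → ∀ p ∈ GG Ω E lam, (dyadCube p.1 p.2 ∩ ball x r).Nonempty →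
      (2:ℝ) ^ p.1 ≤ r := by
    rintro r hr hrr ⟨n, k⟩ hp ⟨z, hzQ, hzB⟩
    simp only at hzQ ⊢
    by_contra hlt
    rw [not_le] at hlt
    have hp2 := two_zpos n
    rw [mem_ball] at hzB
    have hsub : dyadCube n k ⊆ ball x (K * 2 ^ n) := by
      intro y hy
      rw [mem_ball]
      have h1 := dy_diam (sub_cc _ _ hy) (sub_cc _ _ hzQ)
      have h2 := dist_triangle y z x
      rw [hK]; nlinarith
    by_cases hsm : K * 2 ^ n < δ0
    · have h1 := H0 (K * 2 ^ n) (by positivity) hsm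
      have e : lam / K ^ d * (K * 2 ^ n) ^ d = lam * (2 ^ n) ^ d := by
        rw [mul_pow]; field_simp
      rw [e, ENNReal.ofReal_mul h0.le, ENNReal.ofReal_pow hp2.le, ← dy_vol n k] at h1
      have h2 := hp.2
      simp only at h2
      refine absurd (h2.trans_le ((measure_mono ?_).trans h1)) (lt_irrefl _)
      rintro y ⟨hyE, hyQ⟩
      exact ⟨hsub hyQ, hyE⟩
    · rw [not_lt] at hsm
      have hnn : n0 ≤ n := by
        have : (2:ℝ) ^ n0 < 2 ^ n := by nlinarith
        exact ((zpow_lt_zpow_iff_right₀ (by norm_num)).1 this).le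
      obtain ⟨s, rfl⟩ := Int.le.dest hnn
      have hx := hcon _ hp
      apply hx
      intro i
      have e : (2:ℝ) ^ (n0 + s) = 2 ^ s * 2 ^ n0 := by
        rw [zpow_add₀ two_ne_zero, zpow_natCast]; ring
      have hz := hzQ i
      have hd := (abs_le.1 (coord_dist z x i))
      simp only [da]
      constructor
      · by_contra hc
        rw [not_le] at hc
        have h1 := (Hr0 i (k i * 2 ^ s)).2 (by push_cast; rw [mul_assoc, ← e]; exact hc)
        push_cast at h1
        rw [mul_assoc, ← e] at h1
        linarith [hz.1, hd.2]
      · by_contra hc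
        rw [not_le] at hc
        have h1 := (Hr0 i ((k i + 1) * 2 ^ s)).1 (by push_cast; rw [mul_assoc, ← e]; linarith)
        push_cast at h1
        rw [mul_assoc, ← e] at h1
        linarith [hz.2, hd.1]
  intro ε hε
  obtain ⟨δ1, hδ1, H1⟩ := nm_mClos.1 hxE (ε * lam / K ^ d) (by positivity)
  refine ⟨min r0 (δ1 / K), lt_min hr0 (by positivity), fun r hr hrδ => ?_⟩
  have hr1 : r < r0 := hrδ.trans_le (min_le_left _ _)
  have hr2 : r < δ1 / K := hrδ.trans_le (min_le_right _ _)
  rw [lt_div_iff₀ hKp] at hr2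
  set F : Set (ℤ × (Fin d → ℤ)) := {p | p ∈ GG Ω E lam ∧ (dyadCube p.1 p.2 ∩ ball x r).Nonempty}
    with hF
  have hFr : ∀ p ∈ F, (2:ℝ) ^ p.1 ≤ r := fun p hp => hsize r hr hr1 p hp.1 hp.2
  obtain ⟨N, hN⟩ := pow_unbounded_of_one_lt r (show (1:ℝ) < 2 by norm_num)
  have hFN : ∀ p ∈ F, p.1 ≤ (N : ℤ) := by
    intro p hp
    have : (2:ℝ) ^ p.1 < 2 ^ (N : ℤ) := by
      rw [zpow_natCast]; exact (hFr p hp).trans_lt hN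
    exact ((zpow_lt_zpow_iff_right₀ (by norm_num)).1 this).le
  have hS : ∀ p ∈ maxF F, oc (da p.1 p.2) (2 ^ p.1) ⊆ ball x (r * K) := by
    rintro p hp y hy
    obtain ⟨z, hzQ, hzB⟩ := hp.1.2
    rw [mem_ball] at hzB ⊢
    have h1 := dy_diam (sub_cc _ _ (oc_sub _ _ hy)) (sub_cc _ _ hzQ)
    have h2 := dist_triangle y z x
    have h3 := hFr p hp.1
    have h4 : (d:ℝ) * 2 ^ p.1 ≤ d * r := by gcongr
    rw [hK]; nlinarith
  have hsum := maxF_sum_le F volume _ E hS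
  have hl0 : ENNReal.ofReal lam ≠ 0 := by simp [h0]
  have hmain : ENNReal.ofReal lam *
      volume (ball x r ∩ {x ∈ Ω | ENNReal.ofReal lam < dyadMax Ω E x}) ≤
      ENNReal.ofReal lam * ENNReal.ofReal (ε * r ^ d) := by
    calc _ ≤ ENNReal.ofReal lam * ∑' p : maxF F, volume (dyadCube p.1.1 p.1.2) := by
          gcongr
          refine (measure_mono ?_).trans (measure_iUnion_le _)
          rintro y ⟨hyB, hyU⟩
          obtain ⟨p, hp, hy⟩ := (U_iff Ω E lam y).1 hyU
          obtain ⟨q, hq, hsub⟩ := maxF_cover hFN (p := p) ⟨hp, ⟨y, hy, hyB⟩⟩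
          exact mem_iUnion.2 ⟨⟨q, hq⟩, hsub hy⟩
      _ = ∑' p : maxF F, ENNReal.ofReal lam * volume (dyadCube p.1.1 p.1.2) :=
          ENNReal.tsum_mul_left.symm
      _ ≤ ∑' p : maxF F, volume (E ∩ oc (da p.1.1 p.1.2) (2 ^ p.1.1)) := by
          refine ENNReal.tsum_le_tsum fun p => ?_
          rw [dy_inter]
          exact p.2.1.1.2.le
      _ ≤ _ := hsum
      _ = volume (ball x (r * K) ∩ E) := by rw [inter_comm]
      _ ≤ _ := H1 (r * K) (by positivity) hr2
      _ = _ := by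
          rw [← ENNReal.ofReal_mul h0.le]
          congr 1
          rw [mul_pow]; field_simp
  exact (ENNReal.mul_le_mul_iff_right hl0 (by simp)).1 hmain

lemma E_sub_U {Ω E : Set (EuclideanSpace ℝ (Fin d))} (hΩ : IsOpen Ω) (hE : MeasurableSet E)
    {lam : ℝ} (h0 : 0 < lam) (h1 : lam < 1) :
    volume ((E ∩ Ω) \ {x ∈ Ω | ENNReal.ofReal lam < dyadMax Ω E x}) = 0 := by
  have hn0 : volume (E ∩ mClos Eᶜ) = 0 := by
    have := ae_mClos hE.compl
    rwa [compl_compl] at this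
  refine measure_mono_null ?_ hn0
  rintro x ⟨⟨hxE, hxΩ⟩, hxU⟩
  refine ⟨hxE, ?_⟩
  by_contra hx
  apply hxU
  obtain ⟨n0, H⟩ := dy_dense hE hx h0.le h1
  obtain ⟨r, hr, hB⟩ := Metric.isOpen_iff.1 hΩ x hxΩ
  obtain ⟨n1, hn1⟩ := small_zpow (show 0 < r / (d + 1) by positivity)
  rw [lt_div_iff₀ (by positivity)] at hn1
  have hm := dy_mem (min n0 n1) x
  refine (U_iff Ω E lam x).2 ⟨(min n0 n1, _), ⟨?_, H _ (min_le_left _ _) _ hm⟩, hm⟩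
  intro y hy
  apply hB
  rw [mem_ball]
  have h2 := dy_diam (sub_cc _ _ hy) (sub_cc _ _ hm)
  have h3 : (2:ℝ) ^ (min n0 n1) ≤ 2 ^ n1 := zpow_le_zpow_right₀ (by norm_num) (min_le_right _ _)
  have h4 := two_zpos n1
  have h5 : (d:ℝ) * 2 ^ (min n0 n1) ≤ d * 2 ^ n1 := by gcongr
  nlinarith

lemma clos_compl {Ω E : Set (EuclideanSpace ℝ (Fin d))} (hΩ : IsOpen Ω) (hE : MeasurableSet E)
    {lam : ℝ} (h0 : 0 < lam) (h1 : lam < 1) {x : EuclideanSpace ℝ (Fin d)} (hx : x ∈ Ω)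
    (hU : x ∈ mClos {x ∈ Ω | ENNReal.ofReal lam < dyadMax Ω E x}ᶜ) : x ∈ mClos Eᶜ := by
  by_contra hc
  refine absurd hU (nm_mClos.2 ?_)
  intro ε hε
  obtain ⟨δ, hδ, H⟩ := nm_mClos.1 hc ε hε
  obtain ⟨r0, hr0, hB⟩ := Metric.isOpen_iff.1 hΩ x hx
  refine ⟨min δ r0, lt_min hδ hr0, fun r hr hrd => ?_⟩
  have h2 := H r hr (hrd.trans_le (min_le_left _ _))
  refine le_trans ?_ h2
  calc _ ≤ volume ((ball x r ∩ Eᶜ) ∪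
        ((E ∩ Ω) \ {x ∈ Ω | ENNReal.ofReal lam < dyadMax Ω E x})) := by
        apply measure_mono
        rintro y ⟨hyB, hyU⟩
        by_cases hyE : y ∈ E
        · exact Or.inr ⟨⟨hyE, hB (ball_subset_ball (hrd.le.trans (min_le_right _ _)) hyB)⟩, hyU⟩
        · exact Or.inl ⟨hyB, hyE⟩
    _ ≤ _ := measure_union_le _ _
    _ = _ := by rw [E_sub_U hΩ hE h0 h1, add_zero]
end topo

lemma main_bd {m : ℕ} {Ω E : Set (EuclideanSpace ℝ (Fin (m + 1)))} (hΩ : IsOpen Ω)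
    (hE : MeasurableSet E) {lam : ℝ} (h0 : 0 < lam) (h1 : lam < 1) :
    μH[(m:ℝ)] (mBdry {x ∈ Ω | ENNReal.ofReal lam < dyadMax Ω E x} ∩ Ω) ≤
      (CC m + 1) * ENNReal.ofReal (lam ^ (-(m:ℝ) / ((m:ℝ) + 1))) * μH[(m:ℝ)] (mBdry E ∩ Ω) := by
  set U := {x ∈ Ω | ENNReal.ofReal lam < dyadMax Ω E x} with hUd
  set A := ENNReal.ofReal (lam ^ (-(m:ℝ) / ((m:ℝ) + 1))) with hA
  have hA1 : 1 ≤ A := lam_ge h0 h1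
  let F : ℕ → Set (ℤ × (Fin (m + 1) → ℤ)) := fun N => {p | p ∈ GG Ω E lam ∧ p.1 ≤ (N : ℤ)}
  let S : ℕ → Set (EuclideanSpace ℝ (Fin (m + 1))) := fun N =>
    ⋃ p : maxF (F N), (cc (da p.1.1 p.1.2) (2 ^ p.1.1) \ oc (da p.1.1 p.1.2) (2 ^ p.1.1)) \ mClos E
  have hS : ∀ N, μH[(m:ℝ)] (S N) ≤ CC m * A * μH[(m:ℝ)] (mBdry E ∩ Ω) := by
    intro N
    calc _ ≤ ∑' p : maxF (F N), μH[(m:ℝ)] ((cc (da p.1.1 p.1.2) (2 ^ p.1.1) \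
          oc (da p.1.1 p.1.2) (2 ^ p.1.1)) \ mClos E) := measure_iUnion_le _
      _ ≤ ∑' p : maxF (F N), CC m * A * μH[(m:ℝ)] (mBdry E ∩ oc (da p.1.1 p.1.2) (2 ^ p.1.1)) :=
          ENNReal.tsum_le_tsum fun p => cube_bd hE _ _ h0 h1 p.2.1.1.2
      _ = CC m * A * ∑' p : maxF (F N), μH[(m:ℝ)] (mBdry E ∩ oc (da p.1.1 p.1.2) (2 ^ p.1.1)) :=
          ENNReal.tsum_mul_left
      _ ≤ _ := by
          gcongr
          exact maxF_sum_le (F N) _ _ _ fun p hp => (oc_sub _ _).trans hp.1.1.1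
  let T : ℕ → Set (EuclideanSpace ℝ (Fin (m + 1))) := fun N => ⋂ M ≥ N, S M
  have hT : Monotone T := by
    intro a b hab x hx
    simp only [T, mem_iInter] at hx ⊢
    exact fun M hM => hx M (hab.trans hM)
  have hTm : μH[(m:ℝ)] (⋃ N, T N) ≤ CC m * A * μH[(m:ℝ)] (mBdry E ∩ Ω) := by
    rw [hT.measure_iUnion]
    refine iSup_le fun N => (measure_mono ?_).trans (hS N)
    exact biInter_subset_of_mem (le_refl N)
  have hsub : mBdry U ∩ Ω ⊆ (⋃ N, T N) ∪ (mBdry E ∩ Ω) := by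
    rintro x ⟨⟨hx1, hx2⟩, hxΩ⟩
    by_cases hxE : x ∈ mClos E
    · exact Or.inr ⟨⟨hxE, clos_compl hΩ hE h0 h1 hxΩ hx2⟩, hxΩ⟩
    left
    obtain ⟨p, hp, hxp⟩ := near_cube h0 hxE hx1
    refine mem_iUnion.2 ⟨p.1.toNat, ?_⟩
    simp only [T, mem_iInter]
    intro M hM
    obtain ⟨q, hq, hpq⟩ := maxF_cover (F := F M) (N := M) (fun p hp => hp.2) (p := p)
      ⟨hp, by omega⟩
    refine mem_iUnion.2 ⟨⟨q, hq⟩, ⟨dy_cc_mono hpq hxp, fun hxo => ?_⟩, hxE⟩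
    refine mClos_interior (U := U) ?_ hx2
    refine mem_of_superset ((oc_open _ _).mem_nhds hxo) fun y hy => ?_
    exact (U_iff Ω E lam y).2 ⟨q, hq.1.1, oc_sub _ _ hy⟩
  calc _ ≤ μH[(m:ℝ)] ((⋃ N, T N) ∪ (mBdry E ∩ Ω)) := measure_mono hsub
    _ ≤ _ := measure_union_le _ _
    _ ≤ CC m * A * μH[(m:ℝ)] (mBdry E ∩ Ω) + 1 * A * μH[(m:ℝ)] (mBdry E ∩ Ω) := by
        gcongr
        rw [one_mul]
        exact le_mul_of_one_le_left (by simp) hA1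
    _ = _ := by ring

theorem stmt13 (d : ℕ) (hd : 1 ≤ d) :
    ∃ Cd : ℝ, 0 < Cd ∧
      ∀ (Ω E : Set (EuclideanSpace ℝ (Fin d))), IsOpen Ω → MeasurableSet E →
        HasLocFinitePerimeter E →
        ∀ lam : ℝ, 0 < lam → lam < 1 →
          μH[(d : ℝ) - 1] (mBdry {x ∈ Ω | ENNReal.ofReal lam < dyadMax Ω E x} ∩ Ω)
            ≤ ENNReal.ofReal (Cd * lam ^ (-((d : ℝ) - 1) / d)) *
              μH[(d : ℝ) - 1] (mBdry E ∩ Ω) := by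
  obtain ⟨m, rfl⟩ : ∃ m, d = m + 1 := ⟨d - 1, by omega⟩
  refine ⟨(CC m + 1).toReal, ENNReal.toReal_pos (by simp) (by simp [CC_top]), ?_⟩
  intro Ω E hΩ hE _ lam h0 h1
  have e : (((m + 1 : ℕ) : ℝ) - 1) = m := by push_cast; ring
  rw [e, ENNReal.ofReal_mul ENNReal.toReal_nonneg, ENNReal.ofReal_toReal (by simp [CC_top])]
  have := main_bd hΩ hE h0 h1
  push_cast
  exact this
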